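/- arXiv:math/9909018 — 3 statements merged into one kernel-verified Lean document; each statement's English description precedes it below -/
import Mathlib

section
/- Assume Hypothesis (A). Let 0 ≤ m < n and let ω be a homogeneous polynomial differential m-form over K[x_1,…,x_n] satisfying df^(δ)∧ω = 0 and df^(δ')∧ω = df^(δ)∧ξ for some homogeneous m-form ξ. Then there exists a homogeneous (m−1)-form η such that ω = df^(δ)∧η (for m = 0 the conclusion is that ω = 0). -/
open MvPolynomial

noncomputable section

/-- A polynomial differential `m`-form over `K[x_1,…,x_n]`, recorded by its coefficients:
to each subset `T ⊆ {1,…,n}` of cardinality `m` (the index set `i_1 < ⋯ < i_m` of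
`dx_{i_1} ∧ ⋯ ∧ dx_{i_m}`) we assign a polynomial coefficient. -/
abbrev MForm (K : Type*) [CommSemiring K] (n m : ℕ) : Type _ :=
  ∀ T : Finset (Fin n), T.card = m → MvPolynomial (Fin n) K

/-- The wedge product `dg ∧ ω` of the exterior derivative of `g` with an `m`-form `ω`:
its coefficient on `T = {i_0 < ⋯ < i_m}` is `∑ k, (-1)^k (∂g/∂x_{i_k}) ω(T \ {i_k})`. -/
def wedgeD {K : Type*} [CommRing K] {n m : ℕ} (g : MvPolynomial (Fin n) K)
    (ω : MForm K n m) : MForm K n (m + 1) := fun T hT =>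
  ∑ j ∈ T.attach,
    (-1 : MvPolynomial (Fin n) K) ^ (T.filter (fun i => i < j.1)).card *
      pderiv j.1 g * ω (T.erase j.1) (by rw [Finset.card_erase_of_mem j.2]; omega)

/-- `g` is homogeneous of (possibly negative) degree `d : ℤ`; by convention the only
homogeneous polynomial of negative degree is `0`. -/
def HomogZ {K : Type*} [CommSemiring K] {σ : Type*} (g : MvPolynomial σ K) (d : ℤ) : Prop :=
  g = 0 ∨ ∃ d' : ℕ, (d' : ℤ) = d ∧ g.IsHomogeneous d'

/-- A list of ring elements is a regular sequence when each entry is a nonzerodivisor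
modulo the ideal generated by the preceding entries. -/
def IsRegSeq {R : Type*} [CommRing R] (rs : List R) : Prop :=
  ∀ (i : ℕ) (hi : i < rs.length) (x : R),
    rs[i] * x ∈ Ideal.span {y | ∃ (j : ℕ) (hj : j < i), y = rs[j]'(hj.trans hi)} →
    x ∈ Ideal.span {y | ∃ (j : ℕ) (hj : j < i), y = rs[j]'(hj.trans hi)}

/-- The origin is an isolated critical point of (the polynomial map defined by) `h`:
it is a common zero of all partial derivatives `∂h/∂x_i`, and there is a Zariski-open
neighborhood `U` of the origin (wlog a basic open set `u ≠ 0` with `u(0) ≠ 0`) on which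
the origin is the only common zero of the `∂h/∂x_i`. -/
def IsIsolatedCriticalAtZero {K : Type*} [CommSemiring K] {σ : Type*}
    (h : MvPolynomial σ K) : Prop :=
  (∀ i, eval (0 : σ → K) (pderiv i h) = 0) ∧
  ∃ u : MvPolynomial σ K, eval (0 : σ → K) u ≠ 0 ∧
    ∀ y : σ → K, eval y u ≠ 0 → (∀ i, eval y (pderiv i h) = 0) → y = 0

/-- The dehomogenization of `F` in the affine chart `x_j = 1` of `ℙ^{n-1}`, centered at the
point `a` (which should satisfy `a j = 1`): a polynomial in the `n-1` variables `i ≠ j`. -/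
def chartPoly {K : Type*} [CommRing K] {n : ℕ} (F : MvPolynomial (Fin n) K) (j : Fin n)
    (a : Fin n → K) : MvPolynomial {i : Fin n // i ≠ j} K :=
  aeval (fun i : Fin n => if h : i = j then 1 else X ⟨i, h⟩ + C (a i)) F

/-- `g` is weighted homogeneous of total degree `d`: there are positive integer weights
`α_i` with gcd `1` such that every monomial of `g` has weighted degree `d`
(equivalently, `g(λ^{α_1}x_1,…) = λ^d g(x)`). -/
def IsWeightedHomogTD {K : Type*} [CommSemiring K] {σ : Type*} [Fintype σ]
    (g : MvPolynomial σ K) (d : ℕ) : Prop :=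
  ∃ α : σ → ℕ, (∀ i, 0 < α i) ∧ Finset.univ.gcd α = 1 ∧ IsWeightedHomogeneous α g d

/-- The hypersurface `h = 0` has a weighted homogeneous singularity at the origin, of total
degree `d`: the complete local ring `K[[x]]/(h)` is isomorphic as a `K`-algebra to
`K[[x]]/(g)` for some weighted homogeneous `g` of total degree `d`. -/
def WeightedHomogSing {K : Type*} [Field K] {σ : Type*} [Fintype σ]
    (h : MvPolynomial σ K) (d : ℕ) : Prop :=
  ∃ g : MvPolynomial σ K, IsWeightedHomogTD g d ∧
    Nonempty ((MvPowerSeries σ K ⧸ Ideal.span {(h : MvPowerSeries σ K)}) ≃ₐ[K]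
      MvPowerSeries σ K ⧸ Ideal.span {(g : MvPowerSeries σ K)})

/-- The common zero locus, in the projective space `ℙ^{n-1}`, of a set `S` of
(homogeneous) polynomials. -/
def projZeros {K : Type*} [Field K] {n : ℕ} (S : Set (MvPolynomial (Fin n) K)) :
    Set (Projectivization K (Fin n → K)) :=
  {x | ∃ (v : Fin n → K) (hv : v ≠ 0), Projectivization.mk K v hv = x ∧ ∀ g ∈ S, eval v g = 0}

/-- A homogeneous polynomial `G` in `m` variables defines a smooth hypersurface in `ℙ^{m-1}`:
`G` and its partial derivatives have no common zero in `ℙ^{m-1}`. -/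
def SmoothProj {K : Type*} [Field K] {σ : Type*} (G : MvPolynomial σ K) : Prop :=
  ∀ y : σ → K, y ≠ 0 → ¬ (eval y G = 0 ∧ ∀ i, eval y (pderiv i G) = 0)

/-- `F(x_1,…,x_{n-1},0)`, as a polynomial in the first `n-1` variables. -/
def truncAtLast {K : Type*} [CommRing K] {n : ℕ} (F : MvPolynomial (Fin n) K) :
    MvPolynomial (Fin (n - 1)) K :=
  aeval (fun i : Fin n => if h : (i : ℕ) < n - 1 then X (⟨i, h⟩ : Fin (n - 1)) else 0) F

/-- `F(y_1,…,y_{n-1},1)`, as a polynomial in the first `n-1` variables. -/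
def dehomAtLast {K : Type*} [CommRing K] {n : ℕ} (F : MvPolynomial (Fin n) K) :
    MvPolynomial (Fin (n - 1)) K :=
  aeval (fun i : Fin n => if h : (i : ℕ) < n - 1 then X (⟨i, h⟩ : Fin (n - 1)) else 1) F

/-- The point `(b, 1) ∈ K^n` lying over `b ∈ K^{n-1}` (affine chart `x_n = 1`). -/
def liftPt {K : Type*} [CommRing K] {n : ℕ} (b : Fin (n - 1) → K) : Fin n → K :=
  fun i => if h : (i : ℕ) < n - 1 then b ⟨i, h⟩ else 1

/-- Context of the paper: `f` has degree `δ ≥ 2`, `1 ≤ δ' ≤ δ - 1`, and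
`f = f^(δ) + f^(δ') + (terms of degree < δ')`, with `f^(δ')` the (nonzero) homogeneous
component of second-highest degree. -/
def Setup {K : Type*} [Field K] {n : ℕ} (δ δ' : ℕ) (f : MvPolynomial (Fin n) K) : Prop :=
  f.totalDegree = δ ∧ 2 ≤ δ ∧ 1 ≤ δ' ∧ δ' < δ ∧
  (∀ j, δ' < j → j < δ → homogeneousComponent j f = 0) ∧
  homogeneousComponent δ' f ≠ 0

/-- Hypothesis (A): `p ∤ δ`, `p ∤ δ'`; every singular point of the hypersurface
`f^(δ) = 0` in `ℙ^{n-1}` (taken with a representative normalized by `a j = 1`) is an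
isolated singularity, weighted homogeneous of some total degree `d` with `p ∤ d`,
and does not lie on the hypersurface `f^(δ') = 0`. -/
def HypA {K : Type*} [Field K] {n : ℕ} (p δ δ' : ℕ) (f : MvPolynomial (Fin n) K) : Prop :=
  ¬ (p ∣ δ) ∧ ¬ (p ∣ δ') ∧
  ∀ (a : Fin n → K) (j : Fin n), a j = 1 →
    eval a (homogeneousComponent δ f) = 0 →
    (∀ i, eval a (pderiv i (homogeneousComponent δ f)) = 0) →
    IsIsolatedCriticalAtZero (chartPoly (homogeneousComponent δ f) j a) ∧
    (∃ d : ℕ, ¬ (p ∣ d) ∧ WeightedHomogSing (chartPoly (homogeneousComponent δ f) j a) d) ∧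
    eval a (homogeneousComponent δ' f) ≠ 0

/-- Hypothesis (B): `p ∣ δ`, `p ∤ δ'`, the common zero locus of the `∂f^(δ)/∂x_i` in
`ℙ^{n-1}` is finite and nonempty, and none of its points lies on the hypersurface
`f^(δ') = 0`. -/
def HypB {K : Type*} [Field K] {n : ℕ} (p δ δ' : ℕ) (f : MvPolynomial (Fin n) K) : Prop :=
  (p ∣ δ) ∧ ¬ (p ∣ δ') ∧
  (projZeros {g | ∃ i, g = pderiv i (homogeneousComponent δ f)}).Finite ∧
  (projZeros {g | ∃ i, g = pderiv i (homogeneousComponent δ f)}).Nonempty ∧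
  ∀ a : Fin n → K, a ≠ 0 → (∀ i, eval a (pderiv i (homogeneousComponent δ f)) = 0) →
    eval a (homogeneousComponent δ' f) ≠ 0

/-- The localization of the polynomial ring at the maximal ideal of the point `b`. -/
instance evalKerPrime (K : Type*) [Field K] (σ : Type*) (b : σ → K) :
    (RingHom.ker (eval b : MvPolynomial σ K →+* K)).IsPrime := RingHom.ker_isPrime _

/-- The local ring of affine space at the point `b`, i.e. the localization of the
polynomial ring at the maximal ideal of polynomials vanishing at `b`. -/
abbrev LocAt (K : Type*) [Field K] {σ : Type*} (b : σ → K) :=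
  Localization.AtPrime (RingHom.ker (eval b : MvPolynomial σ K →+* K))

/-- The Milnor number of `h` at the point `b`: the `K`-dimension of the quotient of the
local ring at `b` by the ideal generated by the partial derivatives of `h`. -/
def milnorAt {K : Type*} [Field K] {σ : Type*} (b : σ → K) (h : MvPolynomial σ K) : ℕ :=
  Module.finrank K
    ((LocAt K b) ⧸ Ideal.span (Set.range fun i =>
      algebraMap (MvPolynomial σ K) (LocAt K b) (pderiv i h)))

section Koszul

variable {A : Type*} [CommRing A] {n : ℕ}

/-- sign of `j` in `T` -/
def sgK (A : Type*) [CommRing A] {n : ℕ} (j : Fin n) (T : Finset (Fin n)) : A :=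
  (-1 : A) ^ (T.filter (fun i => i < j)).card

/-- wedge with `∑ v j dx_j` on (inhomogeneous) forms. -/
def wd (v : Fin n → A) : (Finset (Fin n) → A) →ₗ[A] (Finset (Fin n) → A) where
  toFun ω T := ∑ j ∈ T, sgK A j T * v j * ω (T.erase j)
  map_add' x y := by
    funext T
    simp [mul_add, Finset.sum_add_distrib]
  map_smul' a x := by
    funext T
    simp only [Pi.smul_apply, smul_eq_mul, RingHom.id_apply, Finset.mul_sum]
    exact Finset.sum_congr rfl fun j _ => by ring

/-- contraction with the vector `c`. -/
def ct (c : Fin n → A) : (Finset (Fin n) → A) →ₗ[A] (Finset (Fin n) → A) where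
  toFun ω S := ∑ k ∈ Sᶜ, sgK A k S * c k * ω (insert k S)
  map_add' x y := by
    funext T
    simp [mul_add, Finset.sum_add_distrib]
  map_smul' a x := by
    funext T
    simp only [Pi.smul_apply, smul_eq_mul, RingHom.id_apply, Finset.mul_sum]
    exact Finset.sum_congr rfl fun j _ => by ring

theorem wd_apply (v : Fin n → A) (ω : Finset (Fin n) → A) (T : Finset (Fin n)) :
    wd v ω T = ∑ j ∈ T, sgK A j T * v j * ω (T.erase j) := rfl

theorem ct_apply (v : Fin n → A) (ω : Finset (Fin n) → A) (S : Finset (Fin n)) :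
    ct v ω S = ∑ k ∈ Sᶜ, sgK A k S * v k * ω (insert k S) := rfl

theorem sgK_mul_self (j : Fin n) (T : Finset (Fin n)) : sgK A j T * sgK A j T = 1 := by
  unfold sgK
  rw [← pow_add, ← two_mul, pow_mul]; simp

theorem sgK_insert_self (j : Fin n) (T : Finset (Fin n)) :
    sgK A j (insert j T) = sgK A j T := by
  unfold sgK
  rw [Finset.filter_insert]; simp

theorem sgK_erase_self (j : Fin n) (T : Finset (Fin n)) :
    sgK A j (T.erase j) = sgK A j T := by
  unfold sgK
  rw [Finset.filter_erase, Finset.erase_eq_of_notMem]; simp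

theorem sgK_insert {j k : Fin n} {S : Finset (Fin n)} (hk : k ∉ S) :
    sgK A j (insert k S) = (if k < j then -1 else 1) * sgK A j S := by
  unfold sgK
  rw [Finset.filter_insert]
  split_ifs with h
  · rw [Finset.card_insert_of_notMem (by simp [hk]), pow_succ]; ring
  · simp

theorem sgK_erase {j k : Fin n} {S : Finset (Fin n)} (hk : k ∈ S) :
    sgK A j (S.erase k) = (if k < j then -1 else 1) * sgK A j S := by
  have h := sgK_insert (A := A) (j := j) (Finset.notMem_erase k S)
  rw [Finset.insert_erase hk] at h
  rw [h]
  split_ifs <;> ring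

theorem wd_anticomm (v w : Fin n → A) (ω : Finset (Fin n) → A) :
    wd v (wd w ω) = - wd w (wd v ω) := by
  funext T
  simp only [Pi.neg_apply, wd_apply, Finset.mul_sum]
  rw [Finset.sum_sigma', Finset.sum_sigma', ← Finset.sum_neg_distrib]
  refine Finset.sum_bij' (fun x _ => ⟨x.2, x.1⟩) (fun x _ => ⟨x.2, x.1⟩) ?_ ?_ ?_ ?_ ?_
  · rintro ⟨j, k⟩ h
    simp only [Finset.mem_sigma, Finset.mem_erase] at h ⊢
    exact ⟨h.2.2, Ne.symm h.2.1, h.1⟩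
  · rintro ⟨j, k⟩ h
    simp only [Finset.mem_sigma, Finset.mem_erase] at h ⊢
    exact ⟨h.2.2, Ne.symm h.2.1, h.1⟩
  · rintro ⟨j, k⟩ h; rfl
  · rintro ⟨j, k⟩ h; rfl
  · rintro ⟨j, k⟩ h
    simp only [Finset.mem_sigma, Finset.mem_erase] at h
    obtain ⟨hj, hkj, hk⟩ := h
    simp only
    rw [sgK_erase hj, sgK_erase hk, Finset.erase_right_comm]
    rcases lt_or_gt_of_ne hkj with h | h
    · rw [if_neg (not_lt.mpr h.le), if_pos h]; ring
    · rw [if_pos h, if_neg (not_lt.mpr h.le)]; ring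

theorem wd_wd (v : Fin n → A) (ω : Finset (Fin n) → A) : wd v (wd v ω) = 0 := by
  funext T
  simp only [Pi.zero_apply, wd_apply, Finset.mul_sum]
  rw [Finset.sum_sigma']
  refine Finset.sum_involution (fun x _ => ⟨x.2, x.1⟩) ?_ ?_ ?_ ?_
  · rintro ⟨j, k⟩ h
    simp only [Finset.mem_sigma, Finset.mem_erase] at h
    obtain ⟨hj, hkj, hk⟩ := h
    simp only
    rw [sgK_erase hj, sgK_erase hk, Finset.erase_right_comm]
    rcases lt_or_gt_of_ne hkj with h | h
    · rw [if_neg (not_lt.mpr h.le), if_pos h]; ring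
    · rw [if_pos h, if_neg (not_lt.mpr h.le)]; ring
  · rintro ⟨j, k⟩ h _ h2
    simp only [Finset.mem_sigma, Finset.mem_erase] at h
    simp only [Sigma.mk.injEq] at h2
    exact h.2.1 h2.1
  · rintro ⟨j, k⟩ h
    simp only [Finset.mem_sigma, Finset.mem_erase] at h ⊢
    exact ⟨h.2.2, Ne.symm h.2.1, h.1⟩
  · rintro ⟨j, k⟩ h; rfl

theorem ct_wd (c v : Fin n → A) (ω : Finset (Fin n) → A) :
    ct c (wd v ω) + wd v (ct c ω) = (∑ i, c i * v i) • ω := by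
  funext S
  have e1 : ct c (wd v ω) S = ∑ k ∈ Sᶜ, c k * v k * ω S +
      ∑ k ∈ Sᶜ, ∑ j ∈ S, sgK A k S * c k *
        (sgK A j (insert k S) * v j * ω (insert k (S.erase j))) := by
    rw [ct_apply, ← Finset.sum_add_distrib]
    refine Finset.sum_congr rfl fun k hk => ?_
    have hk' : k ∉ S := by simpa using hk
    rw [wd_apply, Finset.sum_insert hk', mul_add, Finset.erase_insert hk', sgK_insert_self,
      Finset.mul_sum]
    congr 1
    · linear_combination (c k * v k * ω S) * sgK_mul_self (A := A) k S
    · refine Finset.sum_congr rfl fun j hj => ?_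
      rw [Finset.erase_insert_of_ne (by rintro rfl; exact hk' hj)]
  have e2 : wd v (ct c ω) S = ∑ j ∈ S, c j * v j * ω S +
      ∑ j ∈ S, ∑ k ∈ Sᶜ, sgK A j S * v j *
        (sgK A k (S.erase j) * c k * ω (insert k (S.erase j))) := by
    rw [wd_apply, ← Finset.sum_add_distrib]
    refine Finset.sum_congr rfl fun j hj => ?_
    have : (S.erase j)ᶜ = insert j Sᶜ := by
      ext x; simp only [Finset.mem_compl, Finset.mem_erase, Finset.mem_insert]; tauto
    rw [ct_apply, this, Finset.sum_insert (by simpa using hj), mul_add, Finset.insert_erase hj,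
      sgK_erase_self, Finset.mul_sum]
    congr 1
    linear_combination (c j * v j * ω S) * sgK_mul_self (A := A) j S
  rw [Pi.add_apply, e1, e2, Finset.sum_comm (s := Sᶜ) (t := S)]
  have e3 : ∑ j ∈ S, ∑ k ∈ Sᶜ, sgK A k S * c k *
        (sgK A j (insert k S) * v j * ω (insert k (S.erase j))) =
      - ∑ j ∈ S, ∑ k ∈ Sᶜ, sgK A j S * v j *
        (sgK A k (S.erase j) * c k * ω (insert k (S.erase j))) := by
    rw [← Finset.sum_neg_distrib]
    refine Finset.sum_congr rfl fun j hj => ?_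
    rw [← Finset.sum_neg_distrib]
    refine Finset.sum_congr rfl fun k hk => ?_
    have hk' : k ∉ S := by simpa using hk
    have hkj : k ≠ j := by rintro rfl; exact hk' hj
    rw [sgK_insert hk', sgK_erase hj]
    rcases lt_or_gt_of_ne hkj with h | h
    · rw [if_pos h, if_neg (not_lt.mpr h.le)]; ring
    · rw [if_neg (not_lt.mpr h.le), if_pos h]; ring
  rw [e3]
  have e4 := Finset.sum_add_sum_compl S (fun j => c j * v j * ω S)
  simp only [Pi.smul_apply, smul_eq_mul, Finset.sum_mul]
  rw [← e4]; ring

/-- naturality -/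
theorem wd_map {B : Type*} [CommRing B] (φ : A →+* B) (v : Fin n → A) (ω : Finset (Fin n) → A) :
    (fun T => φ (wd v ω T)) = wd (fun i => φ (v i)) (fun T => φ (ω T)) := by
  funext T
  simp [wd_apply, sgK, map_sum]

theorem wd_smul_vec (a : A) (v : Fin n → A) (ω : Finset (Fin n) → A) :
    wd (fun i => a * v i) ω = a • wd v ω := by
  funext T
  simp only [wd_apply, Pi.smul_apply, smul_eq_mul, Finset.mul_sum]
  exact Finset.sum_congr rfl fun j _ => by ring

/-- Abstract depth sensitivity. -/
theorem depth_step {ι : Type*} [Finite ι] (deg : ι → ℕ)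
    (d : (ι → A) →ₗ[A] (ι → A)) (hd : ∀ x, d (d x) = 0) (k : ℕ) (I I' : Ideal A) (g : A)
    (hII' : I ≤ I') (hg : g ∈ I') (hI' : ∀ x ∈ I', ∃ y, x - g * y ∈ I)
    (hnz : ∀ x, g * x ∈ I → x ∈ I)
    (s : (ι → A) →ₗ[A] (ι → A)) (hs : ∀ x, d (s x) + s (d x) = g • x)
    (hsdeg : ∀ k x, (∀ i, k + 1 ≤ deg i → x i = 0) → ∀ i, k ≤ deg i → s x i = 0)
    (ih : ∀ x : ι → A, (∀ i, k ≤ deg i → x i = 0) → (∀ i, d x i ∈ I') →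
      ∃ y, ∀ i, (x - d y) i ∈ I') :
    ∀ x : ι → A, (∀ i, k + 1 ≤ deg i → x i = 0) → (∀ i, d x i ∈ I) →
      ∃ y, ∀ i, (x - d y) i ∈ I := by
  intro x hx hdx
  have h0 : ∀ i, s (d x) i ∈ I := fun i => Ideal.map_pi _ _ hdx s i
  have h1 : ∀ i, d (s x) i ∈ I' := by
    intro i
    have := congrFun (hs x) i
    simp only [Pi.add_apply, Pi.smul_apply, smul_eq_mul] at this
    rw [eq_sub_of_add_eq this]
    exact I'.sub_mem (I'.mul_mem_right _ hg) (hII' (h0 i))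
  obtain ⟨y, hy⟩ := ih (s x) (hsdeg k x hx) h1
  choose z hz using fun i => hI' _ (hy i)
  refine ⟨z, fun i => hnz _ ?_⟩
  have h2 : ∀ i, d (s x - d y - g • z) i ∈ I := fun i =>
    Ideal.map_pi _ _ hz d i
  have h3 := congrFun (hs x) i
  have h4 := h2 i
  simp only [map_sub, hd, map_smul, Pi.add_apply, Pi.sub_apply, Pi.smul_apply, smul_eq_mul,
    Pi.zero_apply] at h3 h4 ⊢
  have : g * (x i - d z i) = (d (s x) i - 0 - g * d z i) + s (d x) i := by
    linear_combination -h3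
  rw [this]
  exact I.add_mem h4 (h0 i)

/-- A system of ideals indexed by finite sets of variables behaving like
`(x_i^N : i ∈ T)`. -/
structure RegSys (A : Type*) [CommRing A] (τ : Type*) [DecidableEq τ] (g : τ → A) where
  I : Finset τ → Ideal A
  zero : I ∅ = ⊥
  mono : ∀ T k, I T ≤ I (insert k T)
  mem : ∀ T k, g k ∈ I (insert k T)
  dec : ∀ T k, ∀ x ∈ I (insert k T), ∃ y, x - g k * y ∈ I T
  nz : ∀ T k, k ∉ T → ∀ x, g k * x ∈ I T → x ∈ I T

theorem depth_thm {τ : Type*} [DecidableEq τ] [Fintype τ] {g : τ → A} (RS : RegSys A τ g)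
    {ι : Type*} [Finite ι] (deg : ι → ℕ)
    (d : (ι → A) →ₗ[A] (ι → A)) (hd : ∀ x, d (d x) = 0)
    (hs : ∀ t, ∃ s : (ι → A) →ₗ[A] (ι → A), (∀ x, d (s x) + s (d x) = g t • x) ∧
      (∀ k x, (∀ i, k + 1 ≤ deg i → x i = 0) → ∀ i, k ≤ deg i → s x i = 0))
    (x : ι → A) (hx : ∀ i, Fintype.card τ ≤ deg i → x i = 0) (hdx : d x = 0) :
    ∃ y, x = d y := by
  have key : ∀ (k : ℕ) (T : Finset τ), T.card + k = Fintype.card τ →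
      ∀ x : ι → A, (∀ i, k ≤ deg i → x i = 0) → (∀ i, d x i ∈ RS.I T) →
      ∃ y, ∀ i, (x - d y) i ∈ RS.I T := by
    intro k
    induction k with
    | zero =>
      intro T _ x hx _
      refine ⟨0, fun i => ?_⟩
      simp [hx i (Nat.zero_le _)]
    | succ k ih =>
      intro T hT
      obtain ⟨t, ht⟩ : ∃ t, t ∉ T := by
        by_contra! h
        have : T = Finset.univ := by ext; simp [h]
        subst this
        rw [Finset.card_univ] at hT; omega
      obtain ⟨s, hs1, hs2⟩ := hs t
      exact depth_step deg d hd k (RS.I T) (RS.I (insert t T)) (g t) (RS.mono T t) (RS.mem T t)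
        (RS.dec T t) (RS.nz T t ht) s hs1 hs2
        (ih (insert t T) (by rw [Finset.card_insert_of_notMem ht]; omega))
  obtain ⟨y, hy⟩ := key (Fintype.card τ) ∅ (by simp) x hx (by simp [hdx])
  refine ⟨y, ?_⟩
  rw [RS.zero] at hy
  funext i
  have := hy i
  simp only [Ideal.mem_bot, Pi.sub_apply] at this
  exact sub_eq_zero.mp this

end Koszul

noncomputable section Koszul2

variable {A : Type*} [CommRing A] {n : ℕ}

theorem ct_deg (c : Fin n → A) (k : ℕ) (x : Finset (Fin n) → A)
    (hx : ∀ T : Finset (Fin n), k + 1 ≤ T.card → x T = 0) (S : Finset (Fin n)) (hS : k ≤ S.card) :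
    ct c x S = 0 := by
  rw [ct_apply]
  refine Finset.sum_eq_zero fun j hj => ?_
  rw [hx, mul_zero]
  rw [Finset.card_insert_of_notMem (by simpa using hj)]; omega

theorem koszul_vanish {τ : Type*} [DecidableEq τ] [Fintype τ] {g : τ → A} (RS : RegSys A τ g)
    (v : Fin n → A) (hg : ∀ t, ∃ c : Fin n → A, ∑ i, c i * v i = g t)
    (x : Finset (Fin n) → A) (hx : ∀ T : Finset (Fin n), Fintype.card τ ≤ T.card → x T = 0)
    (hdx : wd v x = 0) : ∃ y, x = wd v y := by
  refine depth_thm RS Finset.card (wd v) (wd_wd v) (fun t => ?_) x hx hdx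
  obtain ⟨c, hc⟩ := hg t
  refine ⟨ct c, fun x => ?_, fun k x hx i hi => ct_deg c k x hx i hi⟩
  rw [add_comm, ct_wd, hc]

theorem local_lemma {τ : Type*} [DecidableEq τ] [Fintype τ] {g : τ → A} (RS : RegSys A τ g)
    (hτ : Fintype.card τ + 1 = n)
    (v w : Fin n → A) (hg : ∀ t, ∃ c : Fin n → A, ∑ i, c i * v i = g t)
    (c : Fin n → A) (hcv : ∑ i, c i * v i = 0) (hcw : IsUnit (∑ i, c i * w i))
    (ω ξ : Finset (Fin n) → A) (hω : ∀ T : Finset (Fin n), n ≤ T.card → ω T = 0)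
    (h1 : wd v ω = 0) (h2 : wd w ω = wd v ξ) : ∃ η, ω = wd v η := by
  have a1 : wd v (ct c ω) = 0 := by
    have := ct_wd c v ω
    rw [h1, map_zero, zero_add, hcv, zero_smul] at this
    exact this
  obtain ⟨ζ, hζ⟩ := koszul_vanish RS v hg (ct c ω)
    (fun T hT => ct_deg c (Fintype.card τ) ω (fun T hT => hω T (by omega)) T hT) a1
  have a2 := ct_wd c w ω
  have a3 := ct_wd c v ξ
  rw [hcv, zero_smul] at a3
  obtain ⟨u, hu⟩ := hcw
  rw [h2, hζ, wd_anticomm, eq_neg_of_add_eq_zero_left a3, ← hu] at a2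
  refine ⟨(↑u⁻¹ : A) • (-ct c ξ - wd w ζ), ?_⟩
  rw [map_smul, map_sub, map_neg, sub_eq_add_neg, a2, smul_smul]
  simp

/-- Differential of the cone. -/
def coneD {ι : Type*} (d : (ι → A) →ₗ[A] (ι → A)) (G : A) :
    (ι ⊕ ι → A) →ₗ[A] (ι ⊕ ι → A) where
  toFun x := Sum.elim (d (fun i => x (Sum.inl i)))
    (G • (fun i => x (Sum.inl i)) - d (fun i => x (Sum.inr i)))
  map_add' x y := by
    have h1 : (fun i => (x + y) (Sum.inl i)) = (fun i => x (Sum.inl i)) + fun i => y (Sum.inl i) := rfl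
    have h2 : (fun i => (x + y) (Sum.inr i)) = (fun i => x (Sum.inr i)) + fun i => y (Sum.inr i) := rfl
    rw [h1, h2, map_add, map_add]
    funext i
    rcases i with i | i <;> simp; ring
  map_smul' a x := by
    have h1 : (fun i => (a • x) (Sum.inl i)) = a • (fun i => x (Sum.inl i)) := rfl
    have h2 : (fun i => (a • x) (Sum.inr i)) = a • (fun i => x (Sum.inr i)) := rfl
    rw [h1, h2, map_smul, map_smul]
    funext i
    rcases i with i | i <;> simp; ring

/-- Homotopy of the cone, combination of a homotopy `s` on `C` and the shift times `b`. -/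
def coneS {ι : Type*} (s : (ι → A) →ₗ[A] (ι → A)) (b : A) :
    (ι ⊕ ι → A) →ₗ[A] (ι ⊕ ι → A) where
  toFun x := Sum.elim (s (fun i => x (Sum.inl i)) + b • (fun i => x (Sum.inr i)))
    (- s (fun i => x (Sum.inr i)))
  map_add' x y := by
    have h1 : (fun i => (x + y) (Sum.inl i)) = (fun i => x (Sum.inl i)) + fun i => y (Sum.inl i) := rfl
    have h2 : (fun i => (x + y) (Sum.inr i)) = (fun i => x (Sum.inr i)) + fun i => y (Sum.inr i) := rfl
    rw [h1, h2, map_add, map_add]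
    funext i
    rcases i with i | i <;> simp <;> ring
  map_smul' a x := by
    have h1 : (fun i => (a • x) (Sum.inl i)) = a • (fun i => x (Sum.inl i)) := rfl
    have h2 : (fun i => (a • x) (Sum.inr i)) = a • (fun i => x (Sum.inr i)) := rfl
    rw [h1, h2, map_smul, map_smul]
    funext i
    rcases i with i | i <;> simp; ring

/-- `G` is a nonzerodivisor on `H^m`, `m < n`. -/
theorem cone_lemma {τ : Type*} [DecidableEq τ] [Fintype τ] {g : τ → A} (RS : RegSys A τ g)
    (hτ : Fintype.card τ = n)
    (v : Fin n → A) (G : A) (hg : ∀ t, ∃ (c : Fin n → A) (b : A), ∑ i, c i * v i + b * G = g t)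
    (ω η : Finset (Fin n) → A) (hω : ∀ T : Finset (Fin n), n ≤ T.card → ω T = 0)
    (h1 : wd v ω = 0) (h2 : G • ω = wd v η) : ∃ η, ω = wd v η := by
  classical
  have hD : ∀ x, coneD (wd v) G (coneD (wd v) G x) = 0 := by
    intro x
    funext i
    rcases i with i | i
    · simp [coneD, wd_wd]
    · have e1 : (fun i => G * x (Sum.inl i) - wd v (fun i => x (Sum.inr i)) i) =
        G • (fun i => x (Sum.inl i)) - wd v (fun i => x (Sum.inr i)) := rfl
      simp [coneD]
      rw [e1, map_sub, map_smul, wd_wd]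
      simp
  let η' : Finset (Fin n) → A := fun S => if S.card + 1 < n then η S else 0
  have h2' : G • ω = wd v η' := by
    rw [h2]
    funext T
    by_cases hT : T.card < n
    · simp only [wd_apply]
      refine Finset.sum_congr rfl fun j hj => ?_
      have : (T.erase j).card + 1 < n := by rw [Finset.card_erase_add_one hj]; exact hT
      simp [η', this]
    · have e := congrFun h2 T
      rw [← e]
      simp only [wd_apply, Pi.smul_apply, hω T (not_lt.mp hT), smul_zero]
      symm
      refine Finset.sum_eq_zero fun j hj => ?_
      have : ¬ (T.erase j).card + 1 < n := by rw [Finset.card_erase_add_one hj]; exact hT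
      simp [η', this]
  have key : ∃ y, Sum.elim ω η' = coneD (wd v) G y := by
    refine depth_thm RS (Sum.elim Finset.card (fun T => Finset.card T + 1))
      (coneD (wd v) G) hD ?_ (Sum.elim ω η') ?_ ?_
    · intro t
      obtain ⟨c, b, hcb⟩ := hg t
      refine ⟨coneS (ct c) b, fun x => ?_, fun k x hx i hi => ?_⟩
      · have a1 := ct_wd c v (fun i => x (Sum.inl i))
        have a2 := ct_wd c v (fun i => x (Sum.inr i))
        funext i
        rcases i with i | i
        · have := congrFun a1 i
          simp only [coneD, coneS, LinearMap.coe_mk, AddHom.coe_mk, Pi.add_apply, Sum.elim_inl,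
            Sum.elim_inr, Pi.smul_apply, smul_eq_mul, ← hcb] at this ⊢
          have e1 : wd v (fun i => (ct c) (fun i => x (Sum.inl i)) i + b * x (Sum.inr i)) i =
            wd v (ct c (fun i => x (Sum.inl i))) i + b * wd v (fun i => x (Sum.inr i)) i := by
            have : (fun i => (ct c) (fun i => x (Sum.inl i)) i + b * x (Sum.inr i)) =
              ct c (fun i => x (Sum.inl i)) + b • (fun i => x (Sum.inr i)) := rfl
            rw [this, map_add, map_smul]; rfl
          simp only [Pi.sub_apply, Pi.smul_apply, smul_eq_mul]
          rw [e1]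
          linear_combination this
        · have := congrFun a2 i
          simp only [coneD, coneS, LinearMap.coe_mk, AddHom.coe_mk, Pi.add_apply, Sum.elim_inl,
            Sum.elim_inr, Pi.smul_apply, smul_eq_mul, ← hcb, Pi.neg_apply, Pi.sub_apply] at this ⊢
          have e1 : wd v (fun i => - (ct c) (fun i => x (Sum.inr i)) i) i =
            - wd v (ct c (fun i => x (Sum.inr i))) i := by
            have : (fun i => - (ct c) (fun i => x (Sum.inr i)) i) =
              - ct c (fun i => x (Sum.inr i)) := rfl
            rw [this, map_neg]; rfl
          have e2 : ct c (fun i => G * x (Sum.inl i) - wd v (fun i => x (Sum.inr i)) i) i =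
            G * ct c (fun i => x (Sum.inl i)) i - ct c (wd v (fun i => x (Sum.inr i))) i := by
            have : (fun i => G * x (Sum.inl i) - wd v (fun i => x (Sum.inr i)) i) =
              G • (fun i => x (Sum.inl i)) - wd v (fun i => x (Sum.inr i)) := rfl
            rw [this, map_sub, map_smul]; rfl
          rw [e1, e2]
          linear_combination this
      · rcases i with i | i
        · simp only [Sum.elim_inl] at hi
          simp only [coneS, LinearMap.coe_mk, AddHom.coe_mk, Sum.elim_inl, Pi.add_apply,
            Pi.smul_apply, smul_eq_mul]
          rw [ct_deg c k _ (fun T hT => hx (Sum.inl T) hT) i hi, hx (Sum.inr i) (by simpa using hi)]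
          simp
        · simp only [Sum.elim_inr] at hi
          simp only [coneS, LinearMap.coe_mk, AddHom.coe_mk, Sum.elim_inr, Pi.neg_apply]
          rcases k with _ | k
          · have : (fun i => x (Sum.inr i)) = 0 := by
              funext j; exact hx (Sum.inr j) (by simp)
            rw [this]; simp
          · rw [ct_deg c k _ (fun T hT => hx (Sum.inr T) (by simpa using hT)) i (by omega)]
            simp
    · rintro (T | T) hT
      · exact hω T (by simpa [hτ] using hT)
      · simp only [Sum.elim_inr, hτ] at hT ⊢
        simp [η', not_lt.mpr hT]
    · funext i
      rcases i with i | i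
      · simpa [coneD] using congrFun h1 i
      · have := congrFun h2' i
        simp only [Pi.smul_apply, smul_eq_mul] at this
        simp [coneD, this]
  obtain ⟨y, hy⟩ := key
  refine ⟨fun i => y (Sum.inl i), ?_⟩
  funext T
  exact congrFun hy (Sum.inl T)

/-- `(x_i^N : i ∈ T)` in power series. -/
def psIdeal (τ K : Type*) [Field K] (N : ℕ) (T : Finset τ) : Ideal (MvPowerSeries τ K) where
  carrier := {P | ∀ e : τ →₀ ℕ, (∀ t ∈ T, e t < N) → MvPowerSeries.coeff e P = 0}
  add_mem' := by
    intro a b ha hb e he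
    rw [map_add, ha e he, hb e he, add_zero]
  zero_mem' := by intro e _; simp
  smul_mem' := by
    classical
    intro c x hx e he
    rw [smul_eq_mul, MvPowerSeries.coeff_mul]
    refine Finset.sum_eq_zero fun p hp => ?_
    rw [hx p.2 (fun t ht => ?_), mul_zero]
    rw [Finset.HasAntidiagonal.mem_antidiagonal] at hp
    have := he t ht
    rw [← hp, Finsupp.add_apply] at this
    omega

theorem mem_psIdeal {τ K : Type*} [Field K] {N : ℕ} {T : Finset τ} {P : MvPowerSeries τ K} :
    P ∈ psIdeal τ K N T ↔
      ∀ e : τ →₀ ℕ, (∀ t ∈ T, e t < N) → MvPowerSeries.coeff e P = 0 := Iff.rfl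

/-- The regular system of powers of variables in power series. -/
def psRegSys (τ K : Type*) [Field K] [DecidableEq τ] (N : ℕ) :
    RegSys (MvPowerSeries τ K) τ (fun t => MvPowerSeries.X t ^ N) where
  I := psIdeal τ K N
  zero := by
    refine le_bot_iff.mp fun P hP => ?_
    rw [Ideal.mem_bot]
    ext e
    exact hP e (by simp)
  mono T k P hP e he := hP e fun t ht => he t (Finset.mem_insert_of_mem ht)
  mem T k e he := by
    rw [MvPowerSeries.coeff_X_pow, if_neg]
    rintro rfl
    have := he k (Finset.mem_insert_self _ _)
    simp at this
  dec T k P hP := by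
    let Y : MvPowerSeries τ K := fun e => MvPowerSeries.coeff (e + Finsupp.single k N) P
    have hY : ∀ e, MvPowerSeries.coeff e Y = MvPowerSeries.coeff (e + Finsupp.single k N) P :=
      fun _ => rfl
    refine ⟨Y, fun e he => ?_⟩
    rw [map_sub, MvPowerSeries.X_pow_eq, MvPowerSeries.coeff_monomial_mul]
    split_ifs with h
    · rw [one_mul]
      rw [hY, tsub_add_cancel_of_le h, sub_self]
    · rw [sub_zero]
      refine hP e fun t ht => ?_
      rcases Finset.mem_insert.mp ht with rfl | ht
      · by_contra h'
        exact h (by rw [Finsupp.single_le_iff]; omega)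
      · exact he t ht
  nz T k hk P hP e he := by
    have := hP (e + Finsupp.single k N) (fun t ht => by
      have : k ≠ t := by rintro rfl; exact hk ht
      simpa [Finsupp.single_apply, this] using he t ht)
    rw [MvPowerSeries.X_pow_eq, MvPowerSeries.coeff_monomial_mul] at this
    simpa using this

/-- The regular system of powers of variables in polynomials. -/
def polyRegSys (τ K : Type*) [Field K] [DecidableEq τ] (N : ℕ) :
    RegSys (MvPolynomial τ K) τ (fun t => MvPolynomial.X t ^ N) where
  I T := (psIdeal τ K N T).comap (MvPolynomial.coeToMvPowerSeries.ringHom)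
  zero := by
    refine le_bot_iff.mp fun P hP => ?_
    rw [Ideal.mem_bot]
    ext e
    have := hP e (by simp)
    simpa using this
  mono T k P hP := (psRegSys τ K N).mono T k hP
  mem T k := by
    rw [Ideal.mem_comap]
    have := (psRegSys τ K N).mem T k
    change _ ∈ psIdeal τ K N (insert k T) at this
    simpa using this
  dec T k P hP := by
    refine ⟨P.divMonomial (Finsupp.single k N), ?_⟩
    rw [Ideal.mem_comap]
    intro e he
    have hP' := mem_psIdeal.mp (Ideal.mem_comap.mp hP)
    simp only [coeToMvPowerSeries.ringHom_apply, MvPolynomial.coeff_coe] at hP' ⊢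
    rw [X_pow_eq_monomial, MvPolynomial.coeff_sub, MvPolynomial.coeff_monomial_mul']
    split_ifs with h
    · rw [one_mul, coeff_divMonomial, add_tsub_cancel_of_le h, sub_self]
    · rw [sub_zero]
      refine hP' e fun t ht => ?_
      rcases Finset.mem_insert.mp ht with rfl | ht
      · by_contra h'
        exact h (by rw [Finsupp.single_le_iff]; omega)
      · exact he t ht
  nz T k hk P hP := by
    rw [Ideal.mem_comap] at hP ⊢
    refine (psRegSys τ K N).nz T k hk _ ?_
    change _ ∈ psIdeal τ K N T
    simpa using hP

end Koszul2

noncomputable section Euler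

variable {K : Type*} [Field K] {σ : Type*}

theorem ps_mem_pow [Finite σ] (N : ℕ) : ∀ (r : MvPowerSeries σ K),
    (∀ e : σ →₀ ℕ, e.degree < N → MvPowerSeries.coeff e r = 0) →
    r ∈ (Ideal.span (Set.range (MvPowerSeries.X (σ := σ) (R := K)))) ^ N := by
  classical
  cases nonempty_fintype σ
  induction N with
  | zero => intro r _; simp
  | succ N ih =>
    intro r hr
    have hch : ∀ e : σ →₀ ℕ, e ≠ 0 → ∃ i, e i ≠ 0 := by
      intro e he
      by_contra! h
      exact he (Finsupp.ext h)
    let ch : (σ →₀ ℕ) → σ → Prop := fun e i => ∃ h : e ≠ 0, i = (hch e h).choose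
    let Y : σ → MvPowerSeries σ K := fun i e =>
      if ch (e + Finsupp.single i 1) i then MvPowerSeries.coeff (e + Finsupp.single i 1) r else 0
    have hY : ∀ i e, MvPowerSeries.coeff e (Y i) = if ch (e + Finsupp.single i 1) i then
        MvPowerSeries.coeff (e + Finsupp.single i 1) r else 0 := fun _ _ => rfl
    have hsum : r = ∑ i, MvPowerSeries.X i * Y i := by
      ext e
      rw [map_sum]
      have h1 : ∀ i, MvPowerSeries.coeff e (MvPowerSeries.X i * Y i) =
          if ch e i then MvPowerSeries.coeff e r else 0 := by
        intro i
        rw [MvPowerSeries.X, MvPowerSeries.coeff_monomial_mul]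
        split_ifs with h2 h3 h3
        · rw [one_mul, hY, tsub_add_cancel_of_le h2, if_pos h3]
        · rw [one_mul, hY, tsub_add_cancel_of_le h2, if_neg h3]
        · exfalso
          obtain ⟨h4, h5⟩ := h3
          have := (hch e h4).choose_spec
          rw [← h5] at this
          apply h2
          rw [Finsupp.single_le_iff]; omega
        · rfl
      simp only [h1]
      by_cases he : e = 0
      · subst he
        rw [hr 0 (by simp)]; simp
      · rw [Finset.sum_eq_single (hch e he).choose]
        · rw [if_pos ⟨he, rfl⟩]
        · intro i _ hi
          rw [if_neg]
          rintro ⟨h, h'⟩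
          exact hi h'
        · simp
    rw [hsum]
    refine Ideal.sum_mem _ fun i _ => ?_
    rw [pow_succ']
    refine Ideal.mul_mem_mul (Ideal.subset_span ⟨i, rfl⟩) (ih _ fun e he => ?_)
    rw [hY]
    split_ifs with h
    · refine hr _ ?_
      rw [map_add, Finsupp.degree_single]; omega
    · rfl

theorem const_of_mem_span {x : MvPowerSeries σ K}
    (hx : x ∈ (Ideal.span (Set.range (MvPowerSeries.X (σ := σ) (R := K))))) :
    MvPowerSeries.constantCoeff x = 0 := by
  have : Ideal.span (Set.range (MvPowerSeries.X (σ := σ) (R := K))) ≤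
      RingHom.ker (MvPowerSeries.constantCoeff (σ := σ) (R := K)) := by
    rw [Ideal.span_le]
    rintro _ ⟨i, rfl⟩
    simp [RingHom.mem_ker]
  exact this hx

abbrev QS (a : MvPowerSeries σ K) := MvPowerSeries σ K ⧸ Ideal.span {a}

theorem QS_unit {a : MvPowerSeries σ K} (ha : MvPowerSeries.constantCoeff a = 0)
    {x : MvPowerSeries σ K} (hx : IsUnit (Ideal.Quotient.mk (Ideal.span {a}) x)) :
    MvPowerSeries.constantCoeff x ≠ 0 := by
  obtain ⟨y, hy⟩ := hx.exists_right_inv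
  obtain ⟨y, rfl⟩ := Ideal.Quotient.mk_surjective y
  rw [← map_mul, ← map_one (Ideal.Quotient.mk (Ideal.span {a})), Ideal.Quotient.eq,
    Ideal.mem_span_singleton] at hy
  obtain ⟨z, hz⟩ := hy
  intro h
  have := congrArg MvPowerSeries.constantCoeff hz
  simp [h, ha] at this

theorem iso_const {a b : MvPowerSeries σ K} (ha : MvPowerSeries.constantCoeff a = 0)
    (e : QS a ≃ₐ[K] QS b) {x y : MvPowerSeries σ K}
    (hxy : Ideal.Quotient.mk (Ideal.span {b}) y = e (Ideal.Quotient.mk (Ideal.span {a}) x))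
    (hx : MvPowerSeries.constantCoeff x = 0) : MvPowerSeries.constantCoeff y = 0 := by
  by_contra h
  have h1 : IsUnit y := MvPowerSeries.isUnit_iff_constantCoeff.mpr (isUnit_iff_ne_zero.mpr h)
  have h2 := h1.map (Ideal.Quotient.mk (Ideal.span {b}))
  rw [hxy] at h2
  have h3 : IsUnit (Ideal.Quotient.mk (Ideal.span {a}) x) := by
    simpa using h2.map e.symm
  exact QS_unit ha h3 hx

theorem iso_subst [Finite σ] {a b : MvPowerSeries σ K}
    (ha : MvPowerSeries.constantCoeff a = 0) (hb : MvPowerSeries.constantCoeff b = 0)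
    (e : QS a ≃ₐ[K] QS b) {c : σ → MvPowerSeries σ K}
    (hc : ∀ i, Ideal.Quotient.mk (Ideal.span {b}) (c i) =
      e (Ideal.Quotient.mk (Ideal.span {a}) (MvPowerSeries.X i)))
    (hs : MvPowerSeries.HasSubst c) (x : MvPowerSeries σ K) :
    Ideal.Quotient.mk (Ideal.span {b}) (MvPowerSeries.substAlgHom hs x : MvPowerSeries σ K) =
      e (Ideal.Quotient.mk (Ideal.span {a}) x) := by
  have hc0 : ∀ i, MvPowerSeries.constantCoeff (c i) = 0 := fun i => iso_const ha e (hc i) (by simp)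
  let α : MvPowerSeries σ K →ₐ[K] QS b := (Ideal.Quotient.mkₐ K (Ideal.span {b})).comp
    (MvPowerSeries.substAlgHom hs)
  let β : MvPowerSeries σ K →ₐ[K] QS b := e.toAlgHom.comp (Ideal.Quotient.mkₐ K (Ideal.span {a}))
  change α x = β x
  have hnt : Nontrivial (QS b) := by
    refine Ideal.Quotient.nontrivial_iff.mpr ?_
    rw [Ne, Ideal.span_singleton_eq_top, MvPowerSeries.isUnit_iff_constantCoeff, hb]
    simp
  have hloc : IsLocalRing (QS b) :=
    IsLocalRing.of_surjective' (Ideal.Quotient.mk (Ideal.span {b})) Ideal.Quotient.mk_surjective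
  have hmem : ∀ y : MvPowerSeries σ K, MvPowerSeries.constantCoeff y = 0 →
      Ideal.Quotient.mk (Ideal.span {b}) y ∈ IsLocalRing.maximalIdeal (QS b) := by
    intro y hy
    rw [IsLocalRing.mem_maximalIdeal, mem_nonunits_iff]
    intro h
    exact QS_unit hb h hy
  have hα : ∀ y : MvPowerSeries σ K, MvPowerSeries.constantCoeff y = 0 →
      α y ∈ IsLocalRing.maximalIdeal (QS b) := by
    intro y hy
    refine hmem _ ?_
    change MvPowerSeries.constantCoeff (MvPowerSeries.substAlgHom hs y) = 0
    rw [MvPowerSeries.coe_substAlgHom]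
    exact MvPowerSeries.constantCoeff_subst_eq_zero hs hc0 hy
  have hβ : ∀ y : MvPowerSeries σ K, MvPowerSeries.constantCoeff y = 0 →
      β y ∈ IsLocalRing.maximalIdeal (QS b) := by
    intro y hy
    obtain ⟨z, hz⟩ := Ideal.Quotient.mk_surjective (β y)
    rw [← hz]
    exact hmem _ (iso_const ha e hz hy)
  have hpow : ∀ (γ : MvPowerSeries σ K →ₐ[K] QS b), (∀ y : MvPowerSeries σ K,
      MvPowerSeries.constantCoeff y = 0 → γ y ∈ IsLocalRing.maximalIdeal (QS b)) →
      ∀ N, ∀ y ∈ (Ideal.span (Set.range (MvPowerSeries.X (σ := σ) (R := K)))) ^ N,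
        γ y ∈ IsLocalRing.maximalIdeal (QS b) ^ N := by
    intro γ hγ N y hy
    have h1 : Ideal.map γ (Ideal.span (Set.range (MvPowerSeries.X (σ := σ) (R := K)))) ≤
        IsLocalRing.maximalIdeal (QS b) := by
      rw [Ideal.map_le_iff_le_comap]
      intro z hz
      exact hγ z (const_of_mem_span hz)
    have h2 := Ideal.mem_map_of_mem γ hy
    rw [Ideal.map_pow] at h2
    exact Ideal.pow_right_mono h1 N h2
  have hpoly : ∀ q : MvPolynomial σ K, α (q : MvPowerSeries σ K) = β (q : MvPowerSeries σ K) := by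
    intro q
    induction q using MvPolynomial.induction_on with
    | C r =>
      have : ((C r : MvPolynomial σ K) : MvPowerSeries σ K) = algebraMap K (MvPowerSeries σ K) r := by
        rw [MvPolynomial.coe_C]; rfl
      rw [this, AlgHom.commutes, AlgHom.commutes]
    | add p q hp hq => rw [MvPolynomial.coe_add, map_add, map_add, hp, hq]
    | mul_X p i hp =>
      rw [MvPolynomial.coe_mul, map_mul, map_mul, hp, MvPolynomial.coe_X]
      congr 1
      change Ideal.Quotient.mk (Ideal.span {b}) (MvPowerSeries.substAlgHom hs (MvPowerSeries.X i)) = _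
      rw [MvPowerSeries.substAlgHom_X]
      exact hc i
  have hz : α x - β x ∈ (⨅ i : ℕ, IsLocalRing.maximalIdeal (QS b) ^ i) := by
    rw [Ideal.mem_iInf]
    intro N
    have hr : x - (MvPowerSeries.truncTotal N x : MvPolynomial σ K) ∈
        (Ideal.span (Set.range (MvPowerSeries.X (σ := σ) (R := K)))) ^ N := by
      refine ps_mem_pow N _ fun e he => ?_
      rw [map_sub, MvPolynomial.coeff_coe, MvPowerSeries.coeff_truncTotal _ he, sub_self]
    have h1 := hpow α hα N _ hr
    have h2 := hpow β hβ N _ hr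
    have h3 := Ideal.sub_mem _ h1 h2
    rw [map_sub, map_sub, hpoly] at h3
    simpa using h3
  rw [Ideal.iInf_pow_eq_bot_of_isLocalRing _ (IsLocalRing.maximalIdeal.isMaximal _).ne_top] at hz
  exact sub_eq_zero.mp (by simpa using hz)

theorem chain_rule [Fintype σ] {B : Type*} [CommRing B] [Algebra K B] (D : Derivation K B B)
    (c : σ → B) (q : MvPolynomial σ K) :
    D (aeval c q) = ∑ i, aeval c (pderiv i q) * D (c i) := by
  classical
  induction q using MvPolynomial.induction_on with
  | C a => simp
  | add p q hp hq => simp [hp, hq, add_mul, Finset.sum_add_distrib]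
  | mul_X p i hp =>
    simp only [map_mul, aeval_X, Derivation.leibniz, hp, pderiv_X, smul_eq_mul,
      map_add, add_mul, Finset.sum_add_distrib]
    have h1 : ∀ x, aeval c ((Pi.single x 1 : σ → MvPolynomial σ K) i) = if i = x then (1 : B) else 0 := by
      intro x
      rw [Pi.single_apply]; split_ifs <;> simp
    simp only [h1, mul_ite, mul_one, mul_zero, ite_mul, zero_mul, Finset.sum_ite_eq,
      Finset.mem_univ, if_true]
    rw [Finset.mul_sum]
    congr 1
    exact Finset.sum_congr rfl fun j _ => by ring

theorem euler_lemma [Fintype σ] (h : MvPolynomial σ K) (d : ℕ) (hd : (d : K) ≠ 0)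
    (h0 : eval (0 : σ → K) h = 0) (h0' : ∀ i, eval (0 : σ → K) (pderiv i h) = 0)
    (hw : WeightedHomogSing h d) :
    ∃ D : σ → MvPowerSeries σ K, (∀ i, MvPowerSeries.constantCoeff (D i) = 0) ∧
      ∑ i, D i * ((pderiv i h : MvPolynomial σ K) : MvPowerSeries σ K) = h := by
  classical
  by_cases hh : h = 0
  · exact ⟨0, by simp, by simp [hh]⟩
  obtain ⟨g, ⟨wt, hwt, -, hg⟩, ⟨e⟩⟩ := hw
  have hdn : d ≠ 0 := by rintro rfl; simp at hd
  have ev0 : ∀ q : MvPolynomial σ K, eval (0 : σ → K) q = coeff 0 q := by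
    intro q
    rw [← MvPolynomial.constantCoeff_eq]
    exact congrFun (congrArg DFunLike.coe MvPolynomial.eval_zero) q
  have cc : ∀ q : MvPolynomial σ K, MvPowerSeries.constantCoeff (q : MvPowerSeries σ K)
      = coeff 0 q := by
    intro q
    rw [← MvPowerSeries.coeff_zero_eq_constantCoeff_apply, MvPolynomial.coeff_coe]
  have hg0 : MvPowerSeries.constantCoeff (g : MvPowerSeries σ K) = 0 := by
    rw [cc]
    by_contra hne
    have := hg hne
    simp at this
    exact hdn this.symm
  have hh0 : MvPowerSeries.constantCoeff (h : MvPowerSeries σ K) = 0 := by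
    rw [cc, ← ev0, h0]
  have hsq : h ∈ idealOfVars σ K * idealOfVars σ K := by
    rw [← pow_two, mem_pow_idealOfVars_iff']
    intro x hx
    by_cases hx0 : x = 0
    · rw [hx0, ← ev0, h0]
    · obtain ⟨i, hi⟩ : ∃ i, x i ≠ 0 := by
        by_contra! h'
        exact hx0 (Finsupp.ext h')
      have hle : Finsupp.single i 1 ≤ x := by
        rw [Finsupp.single_le_iff]; omega
      have hxx : x = (x - Finsupp.single i 1) + Finsupp.single i 1 :=
        (tsub_add_cancel_of_le hle).symm
      have hdeg : (x - Finsupp.single i 1).degree = 0 := by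
        have := congrArg Finsupp.degree hxx
        rw [map_add, Finsupp.degree_single] at this
        omega
      rw [Finsupp.degree_eq_zero_iff] at hdeg
      rw [hdeg, zero_add] at hxx
      have h3 := h0' i
      rw [ev0, coeff_pderiv] at h3
      rw [hxx]
      simpa using h3
  -- lifts
  choose c hc using fun i => Ideal.Quotient.mk_surjective
    (e (Ideal.Quotient.mk (Ideal.span {(h : MvPowerSeries σ K)}) (MvPowerSeries.X i)))
  choose b hb using fun i => Ideal.Quotient.mk_surjective
    (e.symm (Ideal.Quotient.mk (Ideal.span {(g : MvPowerSeries σ K)}) (MvPowerSeries.X i)))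
  have hc0 : ∀ i, MvPowerSeries.constantCoeff (c i) = 0 := fun i => iso_const hh0 e (hc i) (by simp)
  have hb0 : ∀ i, MvPowerSeries.constantCoeff (b i) = 0 :=
    fun i => iso_const hg0 e.symm (hb i) (by simp)
  have hcs := MvPowerSeries.hasSubst_of_constantCoeff_zero hc0
  have hbs := MvPowerSeries.hasSubst_of_constantCoeff_zero hb0
  let χ : MvPowerSeries σ K →ₐ[K] MvPowerSeries σ K := MvPowerSeries.substAlgHom hcs
  let φ : MvPowerSeries σ K →ₐ[K] MvPowerSeries σ K := MvPowerSeries.substAlgHom hbs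
  have hχ : ∀ x, Ideal.Quotient.mk (Ideal.span {(g : MvPowerSeries σ K)}) (χ x) =
      e (Ideal.Quotient.mk (Ideal.span {(h : MvPowerSeries σ K)}) x) :=
    iso_subst hh0 hg0 e hc hcs
  have hφ : ∀ x, Ideal.Quotient.mk (Ideal.span {(h : MvPowerSeries σ K)}) (φ x) =
      e.symm (Ideal.Quotient.mk (Ideal.span {(g : MvPowerSeries σ K)}) x) :=
    iso_subst hg0 hh0 e.symm hb hbs
  have hφ0 : ∀ x, MvPowerSeries.constantCoeff x = 0 → MvPowerSeries.constantCoeff (φ x) = 0 := by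
    intro x hx
    simp only [φ, MvPowerSeries.coe_substAlgHom]
    exact MvPowerSeries.constantCoeff_subst_eq_zero hbs hb0 hx
  have hφχ : ∀ x, ∃ s, φ (χ x) = x + h * s := by
    intro x
    have : Ideal.Quotient.mk (Ideal.span {(h : MvPowerSeries σ K)}) (φ (χ x)) =
        Ideal.Quotient.mk (Ideal.span {(h : MvPowerSeries σ K)}) x := by
      rw [hφ, hχ, AlgEquiv.symm_apply_apply]
    rw [Ideal.Quotient.eq, Ideal.mem_span_singleton] at this
    obtain ⟨s, hs⟩ := this
    exact ⟨s, by rw [← hs]; ring⟩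
  obtain ⟨e', he'⟩ : ∃ e', χ h = g * e' := by
    have : Ideal.Quotient.mk (Ideal.span {(g : MvPowerSeries σ K)}) (χ h) = 0 := by
      rw [hχ, Ideal.Quotient.eq_zero_iff_mem.mpr (Ideal.mem_span_singleton_self _), map_zero]
    rw [Ideal.Quotient.eq_zero_iff_mem, Ideal.mem_span_singleton] at this
    exact this
  obtain ⟨e0, he0⟩ : ∃ e0, φ g = h * e0 := by
    have : Ideal.Quotient.mk (Ideal.span {(h : MvPowerSeries σ K)}) (φ g) = 0 := by
      rw [hφ, Ideal.Quotient.eq_zero_iff_mem.mpr (Ideal.mem_span_singleton_self _), map_zero]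
    rw [Ideal.Quotient.eq_zero_iff_mem, Ideal.mem_span_singleton] at this
    exact this
  have hmu : ∃ μ : MvPowerSeries σ K, MvPowerSeries.constantCoeff μ = 0 ∧
      φ (χ (h : MvPowerSeries σ K)) = (h : MvPowerSeries σ K) + (h : MvPowerSeries σ K) * μ := by
    have key : ∀ q ∈ idealOfVars σ K * idealOfVars σ K,
        ∃ μ : MvPowerSeries σ K, MvPowerSeries.constantCoeff μ = 0 ∧
          φ (χ (q : MvPowerSeries σ K)) = (q : MvPowerSeries σ K) + (h : MvPowerSeries σ K) * μ := by
      intro q hq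
      refine Submodule.mul_induction_on hq ?_ ?_
      · intro x hx y hy
        have hx' : coeff 0 x = 0 := by
          rw [← pow_one (idealOfVars σ K)] at hx
          exact (mem_pow_idealOfVars_iff' 1 x).mp hx 0 (by simp)
        have hy' : coeff 0 y = 0 := by
          rw [← pow_one (idealOfVars σ K)] at hy
          exact (mem_pow_idealOfVars_iff' 1 y).mp hy 0 (by simp)
        obtain ⟨s, hs⟩ := hφχ x
        obtain ⟨t, ht⟩ := hφχ y
        refine ⟨s * y + t * x + h * s * t, ?_, ?_⟩
        · simp only [map_add, map_mul, cc, hx', hy']; simp [← cc, hh0]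
        · rw [MvPolynomial.coe_mul, map_mul, map_mul, hs, ht]; ring
      · rintro x y ⟨s, hs0, hs⟩ ⟨t, ht0, ht⟩
        refine ⟨s + t, by simp [hs0, ht0], ?_⟩
        rw [MvPolynomial.coe_add, map_add, map_add, hs, ht]; ring
    exact key h hsq
  obtain ⟨μ, hμ0, hμ⟩ := hmu
  have hhP : (h : MvPowerSeries σ K) ≠ 0 := by
    simpa using hh
  have hunit : e0 * φ e' = 1 + μ := by
    have : (h : MvPowerSeries σ K) * (e0 * φ e') = h * (1 + μ) := by
      rw [← mul_assoc, ← he0, ← map_mul, ← he', hμ]; ring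
    exact mul_left_cancel₀ hhP this
  have hprod : MvPowerSeries.constantCoeff e0 * MvPowerSeries.constantCoeff (φ e') = 1 := by
    rw [← map_mul, hunit]; simp [hμ0]
  have he0c : MvPowerSeries.constantCoeff e0 ≠ 0 := left_ne_zero_of_mul_eq_one hprod
  have he'c : MvPowerSeries.constantCoeff e' ≠ 0 := fun h' =>
    right_ne_zero_of_mul_eq_one hprod (hφ0 _ h')
  -- Euler derivation
  let D : Derivation K (MvPowerSeries σ K) (MvPowerSeries σ K) :=
    ∑ i, ((wt i : MvPowerSeries σ K) * MvPowerSeries.X i) • MvPowerSeries.pderiv K i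
  have hDap : ∀ x, D x = ∑ i, (wt i : MvPowerSeries σ K) * MvPowerSeries.X i *
      MvPowerSeries.pderiv K i x := by
    intro x
    have := congrFun (map_sum (Derivation.coeFnAddMonoidHom (R := K) (A := MvPowerSeries σ K)
      (M := MvPowerSeries σ K)) (fun i => ((wt i : MvPowerSeries σ K) * MvPowerSeries.X i) •
        MvPowerSeries.pderiv K i) Finset.univ) x
    rw [Finset.sum_apply] at this
    exact this
  have hD0 : ∀ x, MvPowerSeries.constantCoeff (D x) = 0 := by
    intro x
    rw [hDap, map_sum]
    exact Finset.sum_eq_zero fun i _ => by simp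
  have hDg : D g = (d : MvPowerSeries σ K) * g := by
    rw [hDap]
    have h2 := congrArg (fun q : MvPolynomial σ K => (q : MvPowerSeries σ K))
      hg.sum_weight_X_mul_pderiv
    rw [← MvPolynomial.coeToMvPowerSeries.ringHom_apply, map_sum] at h2
    simp only [MvPowerSeries.pderiv_coe]
    have hn : ∀ k : ℕ, (((k : MvPolynomial σ K)) : MvPowerSeries σ K) = (k : MvPowerSeries σ K) := by
      intro k
      rw [← MvPolynomial.coeToMvPowerSeries.ringHom_apply, map_natCast]
    simp only [MvPolynomial.coeToMvPowerSeries.ringHom_apply,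
      nsmul_eq_mul, MvPolynomial.coe_mul, MvPolynomial.coe_X, hn] at h2
    rw [← h2]
    exact Finset.sum_congr rfl fun i _ => by ring
  have hDχ : D (χ h) = g * (D e' + d * e') := by
    rw [he', Derivation.leibniz, hDg]; simp only [smul_eq_mul]; ring
  have hchain : D (χ h) = ∑ i, χ (pderiv i h : MvPolynomial σ K) * D (c i) := by
    simp only [χ, MvPowerSeries.substAlgHom_coe]
    exact chain_rule D c h
  choose s hs using fun i => hφχ ((pderiv i h : MvPolynomial σ K) : MvPowerSeries σ K)
  have hmain : ∑ i, φ (D (c i)) * ((pderiv i h : MvPolynomial σ K) : MvPowerSeries σ K) =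
      h * (e0 * φ (D e' + d * e') - ∑ i, s i * φ (D (c i))) := by
    have h1 := congrArg φ (hchain.symm.trans hDχ)
    rw [map_sum, map_mul, he0] at h1
    simp only [map_mul, hs] at h1
    rw [mul_sub, ← mul_assoc, ← h1, Finset.mul_sum, ← Finset.sum_sub_distrib]
    exact Finset.sum_congr rfl fun i _ => by ring
  set W := e0 * φ (D e' + d * e') - ∑ i, s i * φ (D (c i)) with hW
  have hWu : IsUnit W := by
    rw [MvPowerSeries.isUnit_iff_constantCoeff, isUnit_iff_ne_zero, hW, map_sub, map_sum]
    rw [Finset.sum_eq_zero (fun i _ => by rw [map_mul, hφ0 _ (hD0 _), mul_zero]), sub_zero, map_mul,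
      map_add φ, map_add, hφ0 _ (hD0 _), zero_add, map_mul φ, map_natCast, map_mul, map_natCast]
    exact mul_ne_zero he0c (mul_ne_zero hd (right_ne_zero_of_mul_eq_one hprod))
  obtain ⟨u, hu⟩ := hWu
  refine ⟨fun i => (↑u⁻¹ : MvPowerSeries σ K) * φ (D (c i)), fun i => ?_, ?_⟩
  · rw [map_mul, hφ0 _ (hD0 _), mul_zero]
  · simp only [mul_assoc]
    rw [← Finset.mul_sum, hmain, ← hu, mul_comm (h : MvPowerSeries σ K), ← mul_assoc]
    simp

end Euler

noncomputable section LocalStep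

variable {K : Type*} [Field K] {σ : Type*}

theorem nss [IsAlgClosed K] [Finite σ] (I : Ideal (MvPolynomial σ K)) (q : MvPolynomial σ K)
    (h : ∀ x : σ → K, (∀ p ∈ I, eval x p = 0) → eval x q = 0) : ∃ N, q ^ N ∈ I := by
  have h1 : q ∈ vanishingIdeal K (zeroLocus K I) := by
    rw [mem_vanishingIdeal_iff]
    intro x hx
    rw [mem_zeroLocus_iff] at hx
    exact h x hx
  rw [vanishingIdeal_zeroLocus_eq_radical] at h1
  exact h1

theorem krull_descent [Finite σ] {n : ℕ} (v : Fin n → MvPolynomial σ K)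
    (ω : Finset (Fin n) → MvPolynomial σ K) (η : Finset (Fin n) → MvPowerSeries σ K)
    (h : (fun T => (ω T : MvPowerSeries σ K)) = wd (fun i => (v i : MvPowerSeries σ K)) η) :
    ∃ s : MvPolynomial σ K, eval (0 : σ → K) s ≠ 0 ∧ ∃ ζ, s • ω = wd v ζ := by
  classical
  let Nn := LinearMap.range (wd v)
  have hk : Nn.mkQ ω ∈ (⨅ i : ℕ, (idealOfVars σ K) ^ i • ⊤ :
      Submodule (MvPolynomial σ K) ((Finset (Fin n) → MvPolynomial σ K) ⧸ Nn)) := by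
    rw [Submodule.mem_iInf]
    intro k
    let ηk : Finset (Fin n) → MvPolynomial σ K := fun T => MvPowerSeries.truncTotal k (η T)
    have h1 : ∀ T, (ω - wd v ηk) T ∈ idealOfVars σ K ^ k := by
      intro T
      rw [mem_pow_idealOfVars_iff']
      intro e he
      have h2 : (((ω - wd v ηk) T : MvPolynomial σ K) : MvPowerSeries σ K) =
          wd (fun i => (v i : MvPowerSeries σ K)) (η - fun T => (ηk T : MvPowerSeries σ K)) T := by
        rw [map_sub, ← h]
        have := congrFun (wd_map (MvPolynomial.coeToMvPowerSeries.ringHom (σ := σ) (R := K)) v ηk) T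
        simp only [MvPolynomial.coeToMvPowerSeries.ringHom_apply] at this
        rw [Pi.sub_apply, Pi.sub_apply, ← this,
          ← MvPolynomial.coeToMvPowerSeries.ringHom_apply, map_sub]
        rfl
      rw [← MvPolynomial.coeff_coe, h2, wd_apply, map_sum]
      refine Finset.sum_eq_zero fun j _ => ?_
      rw [MvPowerSeries.coeff_mul]
      refine Finset.sum_eq_zero fun x hx => ?_
      rw [Finset.HasAntidiagonal.mem_antidiagonal] at hx
      have hd : x.2.degree < k := by
        have := congrArg Finsupp.degree hx
        rw [map_add] at this
        omega
      rw [Pi.sub_apply, map_sub, MvPolynomial.coeff_coe, MvPowerSeries.coeff_truncTotal _ hd,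
        sub_self, mul_zero]
    have h3 : Nn.mkQ ω = Nn.mkQ (ω - wd v ηk) := by
      rw [map_sub, show Nn.mkQ (wd v ηk) = 0 from (Submodule.Quotient.mk_eq_zero _).mpr (LinearMap.mem_range_self _ _), sub_zero]
    rw [h3, pi_eq_sum_univ' (ω - wd v ηk), map_sum]
    refine Submodule.sum_mem _ fun T _ => ?_
    rw [map_smul]
    exact Submodule.smul_mem_smul (h1 T) trivial
  rw [Ideal.mem_iInf_smul_pow_eq_bot_iff] at hk
  obtain ⟨⟨r, hr⟩, hk⟩ := hk
  refine ⟨1 - r, ?_, ?_⟩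
  · have : eval (0 : σ → K) r = 0 := by
      have h' : idealOfVars σ K ≤ RingHom.ker (eval (0 : σ → K)) := by
        unfold idealOfVars
        rw [Ideal.span_le]
        rintro _ ⟨i, rfl⟩
        simp [RingHom.mem_ker]
      exact h' hr
    rw [map_sub, this, map_one, sub_zero]; exact one_ne_zero
  · have : Nn.mkQ ((1 - r) • ω) = 0 := by
      rw [map_smul, sub_smul, one_smul]
      simp only at hk
      rw [hk, sub_self]
    obtain ⟨ζ, hζ⟩ := (Submodule.Quotient.mk_eq_zero Nn).mp this
    exact ⟨ζ, hζ.symm⟩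

theorem aeval_scale {B : Type*} [CommRing B] [Algebra K B] (q : MvPolynomial σ K) (d : ℕ)
    (hq : q.IsHomogeneous d) (t : B) (x : σ → B) :
    aeval (fun i => t * x i) q = t ^ d * aeval x q := by
  rw [aeval_def, aeval_def, eval₂_eq, eval₂_eq, Finset.mul_sum]
  refine Finset.sum_congr rfl fun e he => ?_
  have hd : ∑ i ∈ e.support, e i = d := by
    have := hq (mem_support_iff.mp he)
    rw [Finsupp.weight_apply] at this
    simpa [Finsupp.sum] using this
  simp only [mul_pow, Finset.prod_mul_distrib, Finset.prod_pow_eq_pow_sum, hd]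
  ring

variable {n : ℕ}

/-- the chart substitution -/
def chartHom (j : Fin n) (a : Fin n → K) :
    MvPolynomial (Fin n) K →ₐ[K] MvPolynomial {i : Fin n // i ≠ j} K :=
  aeval (fun i : Fin n => if h : i = j then 1 else X ⟨i, h⟩ + C (a i))

/-- embedding into the fraction field -/
abbrev toFr (K : Type*) [Field K] (n : ℕ) :
    MvPolynomial (Fin n) K →+* FractionRing (MvPolynomial (Fin n) K) := algebraMap _ _

/-- dehomogenization inverse -/
def thetaHom (j : Fin n) (a : Fin n → K) :
    MvPolynomial {i : Fin n // i ≠ j} K →ₐ[K] FractionRing (MvPolynomial (Fin n) K) :=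
  aeval (fun i => toFr K n (X i.1)
    / toFr K n (X j) - algebraMap K (FractionRing (MvPolynomial (Fin n) K)) (a i.1))

theorem Xne (j : Fin n) : toFr K n (X j) ≠ 0 := by
  simp [toFr, X_ne_zero]

theorem theta_chart (j : Fin n) (a : Fin n → K) (q : MvPolynomial (Fin n) K) (d : ℕ)
    (hq : q.IsHomogeneous d) :
    toFr K n (X j) ^ d * thetaHom j a (chartHom j a q) =
      toFr K n q := by
  have e1 : (thetaHom j a).comp (chartHom j a) = aeval (fun i =>
      (toFr K n (X j))⁻¹ *
      toFr K n (X i)) := by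
    refine algHom_ext fun i => ?_
    simp only [AlgHom.comp_apply, chartHom, aeval_X]
    split_ifs with h
    · subst h
      rw [map_one, inv_mul_cancel₀ (Xne i)]
    · rw [map_add, ← algebraMap_eq, AlgHom.commutes]
      simp only [thetaHom, aeval_X, sub_add_cancel]
      rw [div_eq_inv_mul]
  have e2 := congrArg (fun g => g q) e1
  simp only [AlgHom.comp_apply] at e2
  rw [e2, aeval_scale q d hq, ← mul_assoc, ← mul_pow, mul_inv_cancel₀ (Xne j), one_pow, one_mul]
  have e3 : (aeval fun i => toFr K n (X i)) =
      IsScalarTower.toAlgHom K (MvPolynomial (Fin n) K) (FractionRing (MvPolynomial (Fin n) K)) :=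
    algHom_ext fun i => by simp
  rw [e3]; rfl

theorem theta_int (j : Fin n) (a : Fin n → K) (b : Fin n → K) (hb : ∀ i, b i = b j * a i)
    (q : MvPolynomial {i : Fin n // i ≠ j} K) :
    ∃ (N : ℕ) (r : MvPolynomial (Fin n) K),
      toFr K n r =
        toFr K n (X j) ^ N * thetaHom j a q ∧
      eval b r = b j ^ N * eval 0 q := by
  induction q using MvPolynomial.induction_on with
  | C c => refine ⟨0, C c, ?_, by simp⟩
           rw [← algebraMap_eq, ← algebraMap_eq, AlgHom.commutes, pow_zero, one_mul,
            ← IsScalarTower.algebraMap_apply]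
  | add p q hp hq =>
    obtain ⟨N, r, h1, h2⟩ := hp
    obtain ⟨M, s, h3, h4⟩ := hq
    refine ⟨N + M, X j ^ M * r + X j ^ N * s, ?_, ?_⟩
    · simp only [map_add, map_mul, map_pow, h1, h3]; ring
    · simp only [map_add, map_mul, map_pow, h2, h4, eval_X]; ring
  | mul_X p i hp =>
    obtain ⟨N, r, h1, h2⟩ := hp
    refine ⟨N + 1, r * (X i.1 - C (a i.1) * X j), ?_, ?_⟩
    · have e : toFr K n (C (a i.1))
          = algebraMap K (FractionRing (MvPolynomial (Fin n) K)) (a i.1) := by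
        rw [← algebraMap_eq, ← IsScalarTower.algebraMap_apply]
      simp only [map_mul, h1, map_sub, thetaHom, aeval_X, e]
      have := Xne (K := K) j
      field_simp
      ring
    · simp only [map_mul, h2, map_sub, eval_X, eval_C, hb i.1]
      simp; right; ring

theorem theta_int_all {ι : Type*} [Finite ι] (j : Fin n) (a : Fin n → K)
    (q : ι → MvPolynomial {i : Fin n // i ≠ j} K) :
    ∃ (N : ℕ), ∀ M, N ≤ M → ∀ t, ∃ (r : MvPolynomial (Fin n) K),
      toFr K n r =
        toFr K n (X j) ^ M * thetaHom j a (q t) := by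
  cases nonempty_fintype ι
  choose N r h1 h2 using fun t => theta_int j a (fun _ => 0) (by simp) (q t)
  refine ⟨Finset.univ.sup N, fun M hM t => ⟨X j ^ (M - N t) * r t, ?_⟩⟩
  have : N t ≤ M := (Finset.le_sup (Finset.mem_univ t)).trans hM
  rw [map_mul, h1, map_pow, ← mul_assoc, ← pow_add, Nat.sub_add_cancel this]

end LocalStep

noncomputable section LocalStep2

variable {K : Type*} [Field K] {n : ℕ}

/-- the formal chart map -/
def kap (j : Fin n) (a : Fin n → K) :
    MvPolynomial (Fin n) K →+* MvPowerSeries {i : Fin n // i ≠ j} K :=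
  (MvPolynomial.coeToMvPowerSeries.ringHom).comp (chartHom j a).toRingHom

theorem kap_apply (j : Fin n) (a : Fin n → K) (q : MvPolynomial (Fin n) K) :
    kap j a q = ((chartHom j a q : MvPolynomial {i : Fin n // i ≠ j} K) :
      MvPowerSeries {i : Fin n // i ≠ j} K) := rfl

theorem kap_const (j : Fin n) (a : Fin n → K) (haj : a j = 1) (q : MvPolynomial (Fin n) K) :
    MvPowerSeries.constantCoeff (kap j a q) = eval a q := by
  have h1 : MvPowerSeries.constantCoeff (kap j a q) = eval 0 (chartHom j a q) := by
    rw [kap_apply, ← MvPowerSeries.coeff_zero_eq_constantCoeff_apply, MvPolynomial.coeff_coe]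
    rw [← MvPolynomial.constantCoeff_eq]
    exact (congrFun (congrArg DFunLike.coe MvPolynomial.eval_zero) _).symm
  rw [h1]
  have h2 : (aeval (0 : {i : Fin n // i ≠ j} → K)).comp (chartHom j a) = aeval a := by
    refine algHom_ext fun i => ?_
    simp only [AlgHom.comp_apply, chartHom, aeval_X]
    split_ifs with h
    · subst h; simp [haj]
    · simp
  have h3 := congrArg (fun g => g q) h2
  simp only [AlgHom.comp_apply] at h3
  exact h3

theorem pderiv_chart (j : Fin n) (a : Fin n → K) (F : MvPolynomial (Fin n) K)
    (i : {i : Fin n // i ≠ j}) :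
    pderiv i (chartPoly F j a) = chartHom j a (pderiv i.1 F) := by
  classical
  unfold chartPoly chartHom
  rw [chain_rule]
  rw [Finset.sum_eq_single i.1]
  · rw [dif_neg i.2, map_add, pderiv_C, add_zero, pderiv_X_self, mul_one]
  · intro k _ hk
    split_ifs with h
    · simp
    · rw [map_add, pderiv_C, add_zero, pderiv_X_of_ne, mul_zero]
      intro h'
      exact hk (congrArg Subtype.val h')
  · simp

theorem formal_local [IsAlgClosed K] (F G : MvPolynomial (Fin n) K) (δ δ' : ℕ)
    (hF : F.IsHomogeneous δ) (hG : G.IsHomogeneous δ') (hδ' : (δ' : K) ≠ 0)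
    (j : Fin n) (a : Fin n → K) (haj : a j = 1) (hF0 : eval a F = 0)
    (hFi : ∀ i, eval a (pderiv i F) = 0) (hGa : eval a G ≠ 0)
    (hiso : IsIsolatedCriticalAtZero (chartPoly F j a)) (d : ℕ) (hd : (d : K) ≠ 0)
    (hw : WeightedHomogSing (chartPoly F j a) d)
    (ω ξ : Finset (Fin n) → MvPolynomial (Fin n) K)
    (hω : ∀ T : Finset (Fin n), n ≤ T.card → ω T = 0)
    (h1 : wd (fun i => pderiv i F) ω = 0)
    (h2 : wd (fun i => pderiv i G) ω = wd (fun i => pderiv i F) ξ) :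
    ∃ η, (fun T => kap j a (ω T)) = wd (fun i => kap j a (pderiv i F)) η := by
  classical
  have hcF : chartPoly F j a = chartHom j a F := rfl
  obtain ⟨D, hD0, hD⟩ := euler_lemma (chartPoly F j a) d hd
    (by
      have := kap_const j a haj F
      rw [kap_apply, ← MvPowerSeries.coeff_zero_eq_constantCoeff_apply, MvPolynomial.coeff_coe,
        ← MvPolynomial.constantCoeff_eq] at this
      rw [hcF, ← hF0, ← this]
      exact (congrFun (congrArg DFunLike.coe MvPolynomial.eval_zero) _))
    hiso.1 hw
  simp only [pderiv_chart] at hD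
  rw [hcF] at hD
  simp only [← kap_apply] at hD
  obtain ⟨u, hu0, hu⟩ := hiso.2
  have hN : ∀ t : {i : Fin n // i ≠ j}, ∃ N, (X t * u) ^ N ∈
      Ideal.span (Set.range fun i : {i : Fin n // i ≠ j} => pderiv i (chartPoly F j a)) := by
    intro t
    refine nss _ _ fun x hx => ?_
    by_cases hux : eval x u = 0
    · simp [hux]
    · rw [hu x hux fun i => hx _ (Ideal.subset_span ⟨i, rfl⟩)]; simp
  choose N hN using hN
  let M := Finset.univ.sup N
  have hM : ∀ t : {i : Fin n // i ≠ j}, (X t * u) ^ M ∈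
      Ideal.span (Set.range fun i : {i : Fin n // i ≠ j} => pderiv i (chartPoly F j a)) := by
    intro t
    exact Ideal.pow_mem_of_pow_mem _ (hN t) (Finset.le_sup (Finset.mem_univ t))
  have huU : IsUnit (u : MvPowerSeries {i : Fin n // i ≠ j} K) := by
    rw [MvPowerSeries.isUnit_iff_constantCoeff, isUnit_iff_ne_zero,
      ← MvPowerSeries.coeff_zero_eq_constantCoeff_apply, MvPolynomial.coeff_coe,
        ← MvPolynomial.constantCoeff_eq]
    intro h
    refine hu0 ?_
    rw [← h]
    exact (congrFun (congrArg DFunLike.coe MvPolynomial.eval_zero) _)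
  obtain ⟨U, hU⟩ := huU
  have hg : ∀ t : {i : Fin n // i ≠ j}, ∃ c : Fin n → MvPowerSeries {i : Fin n // i ≠ j} K,
      ∑ i, c i * kap j a (pderiv i F) = MvPowerSeries.X t ^ M := by
    intro t
    obtain ⟨c, hc⟩ := Ideal.mem_span_range_iff_exists_fun.mp (hM t)
    have hc' := congrArg (MvPolynomial.coeToMvPowerSeries.ringHom
      (σ := {i : Fin n // i ≠ j}) (R := K)) hc
    simp only [map_sum, map_mul, map_pow, pderiv_chart,
      MvPolynomial.coeToMvPowerSeries.ringHom_apply, MvPolynomial.coe_X, ← kap_apply, ← hU] at hc'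
    refine ⟨fun i => if h : i = j then 0 else
      ((U⁻¹ : _ˣ) : MvPowerSeries {i : Fin n // i ≠ j} K) ^ M * (c ⟨i, h⟩ : MvPolynomial _ K), ?_⟩
    rw [Fintype.sum_eq_add_sum_subtype_ne _ j]
    beta_reduce
    rw [dif_pos rfl, zero_mul, zero_add]
    have e1 : ∀ i : {i : Fin n // i ≠ j}, (if h : i.1 = j then 0 else
      ((U⁻¹ : _ˣ) : MvPowerSeries {i : Fin n // i ≠ j} K) ^ M * (c ⟨i.1, h⟩ : MvPolynomial _ K)) *
        kap j a (pderiv i.1 F) = ((U⁻¹ : _ˣ) : MvPowerSeries {i : Fin n // i ≠ j} K) ^ M *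
        ((c i : MvPolynomial _ K) * kap j a (pderiv i.1 F)) := by
      intro i
      rw [dif_neg i.2, mul_assoc]
    rw [Finset.sum_congr rfl fun i _ => e1 i, ← Finset.mul_sum, hc', mul_pow, mul_left_comm,
      ← mul_pow, Units.inv_mul, one_pow, mul_one]
  let D' : Fin n → MvPowerSeries {i : Fin n // i ≠ j} K := fun i => if h : i = j then 0 else D ⟨i, h⟩
  have hD'0 : ∀ i, MvPowerSeries.constantCoeff (D' i) = 0 := by
    intro i
    simp only [D']
    split_ifs with h
    · simp
    · exact hD0 _
  have hD' : ∑ i, D' i * kap j a (pderiv i F) = kap j a F := by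
    rw [Fintype.sum_eq_add_sum_subtype_ne _ j]
    simp only [D', dif_pos, zero_mul, zero_add]
    rw [← hD]
    exact Finset.sum_congr rfl fun i _ => by rw [dif_neg i.2]
  have hEF : ∑ i, kap j a (X i) * kap j a (pderiv i F) =
      (δ : MvPowerSeries {i : Fin n // i ≠ j} K) * kap j a F := by
    have := congrArg (kap j a) hF.sum_X_mul_pderiv
    simpa [map_sum] using this
  refine local_lemma (psRegSys {i : Fin n // i ≠ j} K M) ?_ _ (fun i => kap j a (pderiv i G)) hg
    (fun i => kap j a (X i) - (δ : MvPowerSeries {i : Fin n // i ≠ j} K) * D' i) ?_ ?_ _ (fun T => kap j a (ξ T)) ?_ ?_ ?_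
  · have : 0 < n := j.pos
    have h := Fintype.card_subtype_compl (fun i : Fin n => i = j)
    simp at h
    simp; omega
  · simp only [sub_mul, mul_assoc, Finset.sum_sub_distrib]
    rw [← Finset.mul_sum, hD', hEF, sub_self]
  · rw [MvPowerSeries.isUnit_iff_constantCoeff, isUnit_iff_ne_zero, map_sum]
    have e : ∀ i, MvPowerSeries.constantCoeff ((kap j a (X i) - (δ : MvPowerSeries {i : Fin n // i ≠ j} K) * D' i) * kap j a (pderiv i G)) =
        eval a (X i * pderiv i G) := by
      intro i
      rw [map_mul, map_sub, map_mul, hD'0, mul_zero, sub_zero, kap_const _ _ haj,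
        kap_const _ _ haj, map_mul]
    rw [Finset.sum_congr rfl fun i _ => e i, ← map_sum, hG.sum_X_mul_pderiv]
    simp [hδ', hGa]
  · intro T hT; simp [hω T hT]
  · rw [← wd_map, h1]; simp; rfl
  · rw [← wd_map, ← wd_map, h2]

theorem local_step [IsAlgClosed K] (F G : MvPolynomial (Fin n) K) (δ δ' : ℕ)
    (hF : F.IsHomogeneous δ) (hG : G.IsHomogeneous δ') (hδ' : (δ' : K) ≠ 0)
    (j : Fin n) (a : Fin n → K) (haj : a j = 1) (hF0 : eval a F = 0)
    (hFi : ∀ i, eval a (pderiv i F) = 0) (hGa : eval a G ≠ 0)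
    (hiso : IsIsolatedCriticalAtZero (chartPoly F j a)) (d : ℕ) (hd : (d : K) ≠ 0)
    (hw : WeightedHomogSing (chartPoly F j a) d)
    (ω ξ : Finset (Fin n) → MvPolynomial (Fin n) K)
    (hω : ∀ T : Finset (Fin n), n ≤ T.card → ω T = 0) (l : ℕ) (hl : ∀ T, (ω T).IsHomogeneous l)
    (h1 : wd (fun i => pderiv i F) ω = 0)
    (h2 : wd (fun i => pderiv i G) ω = wd (fun i => pderiv i F) ξ)
    (b : Fin n → K) (hbj : b j ≠ 0) (hb : ∀ i, b i = b j * a i) :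
    ∃ q : MvPolynomial (Fin n) K, eval b q ≠ 0 ∧ ∃ η, q • ω = wd (fun i => pderiv i F) η := by
  obtain ⟨η, hη⟩ := formal_local F G δ δ' hF hG hδ' j a haj hF0 hFi hGa hiso d hd hw ω ξ hω h1 h2
  obtain ⟨s, hs, ζ, hζ⟩ := krull_descent (fun i => chartHom j a (pderiv i F))
    (fun T => chartHom j a (ω T)) η hη
  obtain ⟨N, r, hr, hrb⟩ := theta_int j a b hb s
  obtain ⟨M, hM⟩ := theta_int_all j a ζ
  choose z hz using hM (M + N) (by omega)
  have hinj : Function.Injective (toFr K n) := IsFractionRing.injective _ _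
  refine ⟨X j ^ (M + (δ - 1)) * r, ?_, fun T => X j ^ l * z T, ?_⟩
  · rw [map_mul, hrb, map_pow, eval_X]
    exact mul_ne_zero (pow_ne_zero _ hbj) (mul_ne_zero (pow_ne_zero _ hbj) hs)
  · funext T
    apply hinj
    have e1 := congrFun (congrArg (fun x => fun T => thetaHom j a (x T)) hζ) T
    have e2 := congrFun (wd_map (thetaHom j a).toRingHom (fun i => chartHom j a (pderiv i F)) ζ) T
    have e3 := congrFun (wd_map (toFr K n) (fun i => pderiv i F) (fun T => X j ^ l * z T)) T
    rw [e3]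
    change thetaHom j a _ = _ at e2
    rw [e2] at e1
    simp only [Pi.smul_apply, smul_eq_mul, map_mul, map_pow, hr]
    have e4 : (fun i => toFr K n (pderiv i F)) = fun i => toFr K n (X j) ^ (δ - 1) *
        thetaHom j a (chartHom j a (pderiv i F)) := by
      funext i
      rw [theta_chart j a _ (δ - 1) hF.pderiv]
    have e5 : (fun T => toFr K n (X j) ^ l * toFr K n (z T)) =
        (toFr K n (X j) ^ (l + (M + N))) • fun T => thetaHom j a (ζ T) := by
      funext T
      rw [hz, Pi.smul_apply, smul_eq_mul]; ring
    rw [e4, wd_smul_vec, e5, map_smul]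
    simp only [Pi.smul_apply, smul_eq_mul]
    change _ = wd (fun i => thetaHom j a (chartHom j a (pderiv i F))) (fun T => thetaHom j a (ζ T)) T
      at e1
    rw [← e1, Pi.smul_apply, smul_eq_mul, map_mul, ← theta_chart j a _ l (hl T)]
    ring

end LocalStep2

noncomputable section Global

variable {K : Type*} [Field K] {n : ℕ}

theorem eval_scale (q : MvPolynomial (Fin n) K) (d : ℕ) (hq : q.IsHomogeneous d) (t : K)
    (x y : Fin n → K) (h : ∀ i, x i = t * y i) : eval x q = t ^ d * eval y q := by
  have := aeval_scale q d hq t y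
  rw [← funext h] at this
  exact this

theorem global_thm [IsAlgClosed K] (F G : MvPolynomial (Fin n) K) (δ δ' : ℕ)
    (hF : F.IsHomogeneous δ) (hG : G.IsHomogeneous δ') (hδ : (δ : K) ≠ 0) (hδ' : (δ' : K) ≠ 0)
    (hsing : ∀ (a : Fin n → K) (j : Fin n), a j = 1 → eval a F = 0 →
      (∀ i, eval a (pderiv i F) = 0) → IsIsolatedCriticalAtZero (chartPoly F j a) ∧
      (∃ d : ℕ, (d : K) ≠ 0 ∧ WeightedHomogSing (chartPoly F j a) d) ∧ eval a G ≠ 0)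
    (ω ξ : Finset (Fin n) → MvPolynomial (Fin n) K)
    (hω : ∀ T : Finset (Fin n), n ≤ T.card → ω T = 0) (l : ℕ) (hl : ∀ T, (ω T).IsHomogeneous l)
    (h1 : wd (fun i => pderiv i F) ω = 0)
    (h2 : wd (fun i => pderiv i G) ω = wd (fun i => pderiv i F) ξ) :
    ∃ η, ω = wd (fun i => pderiv i F) η := by
  classical
  -- singular points
  have hpt : ∀ x : Fin n → K, x ≠ 0 → (∀ i, eval x (pderiv i F) = 0) →
      ∃ (j : Fin n) (a : Fin n → K), a j = 1 ∧ x j ≠ 0 ∧ (∀ i, x i = x j * a i) ∧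
        eval a F = 0 ∧ (∀ i, eval a (pderiv i F) = 0) := by
    intro x hx hxF
    obtain ⟨j, hj⟩ : ∃ j, x j ≠ 0 := by
      by_contra! h
      exact hx (funext h)
    have hs : ∀ i, x i = x j * (x i / x j) := fun i => by field_simp
    have hFa : ∀ i, eval (fun i => x i / x j) (pderiv i F) = 0 := by
      intro i
      have := eval_scale _ (δ - 1) (hF.pderiv (i := i)) (x j) x (fun i => x i / x j) hs
      rw [hxF i] at this
      exact (mul_eq_zero.mp this.symm).resolve_left (pow_ne_zero _ hj)
    refine ⟨j, fun i => x i / x j, div_self hj, hj, hs, ?_, hFa⟩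
    have := congrArg (eval (fun i => x i / x j)) hF.sum_X_mul_pderiv
    rw [map_sum, Finset.sum_eq_zero (fun i _ => by rw [map_mul, hFa, mul_zero])] at this
    rw [nsmul_eq_mul, map_mul, map_natCast] at this
    exact (mul_eq_zero.mp this.symm).resolve_left hδ
  let Q : Ideal (MvPolynomial (Fin n) K) := (LinearMap.range (wd (fun i => pderiv i F))).comap
    (LinearMap.toSpanSingleton (MvPolynomial (Fin n) K) _ ω)
  have hQ : ∀ q, q ∈ Q ↔ ∃ η, wd (fun i => pderiv i F) η = q • ω := fun q => Iff.rfl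
  have hFQ : ∀ i, pderiv i F ∈ Q := by
    intro i
    rw [hQ]
    refine ⟨ct (Pi.single i 1) ω, ?_⟩
    have := ct_wd (Pi.single i 1) (fun i => pderiv i F) ω
    rw [h1, map_zero, zero_add] at this
    rw [this]
    congr 1
    simp [Pi.single_apply]
  obtain ⟨N, hN⟩ := nss Q G (by
    intro x hx
    by_cases hx0 : x = 0
    · have := congrArg (eval x) hG.sum_X_mul_pderiv
      rw [map_sum, Finset.sum_eq_zero (fun i _ => by rw [map_mul, eval_X, hx0]; simp)] at this
      rw [nsmul_eq_mul, map_mul, map_natCast] at this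
      exact (mul_eq_zero.mp this.symm).resolve_left hδ'
    · exfalso
      obtain ⟨j, a, haj, hxj, hxa, hFa, hFia⟩ := hpt x hx0 (fun i => hx _ (hFQ i))
      obtain ⟨hiso, ⟨d, hd, hw⟩, hGa⟩ := hsing a j haj hFa hFia
      obtain ⟨q, hq, η, hη⟩ := local_step F G δ δ' hF hG hδ' j a haj hFa hFia hGa hiso d hd hw ω ξ
        hω l hl h1 h2 x hxj hxa
      exact hq (hx q ((hQ q).mpr ⟨η, hη.symm⟩)))
  obtain ⟨η, hη⟩ := (hQ _).mp hN
  have hX : ∀ t : Fin n, ∃ M, (X t : MvPolynomial (Fin n) K) ^ M ∈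
      Ideal.span (Set.range fun i => pderiv i F) ⊔ Ideal.span {G ^ N} := by
    intro t
    refine nss _ _ fun x hx => ?_
    by_cases hx0 : x = 0
    · simp [hx0]
    · exfalso
      obtain ⟨j, a, haj, hxj, hxa, hFa, hFia⟩ := hpt x hx0
        (fun i => hx _ (Ideal.mem_sup_left (Ideal.subset_span ⟨i, rfl⟩)))
      obtain ⟨-, -, hGa⟩ := hsing a j haj hFa hFia
      have hG1 := hx _ (Ideal.mem_sup_right (Ideal.mem_span_singleton_self _))
      rw [map_pow, eval_scale _ δ' hG (x j) x a hxa] at hG1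
      exact pow_ne_zero _ (mul_ne_zero (pow_ne_zero _ hxj) hGa) hG1
  choose M hM using hX
  refine cone_lemma (polyRegSys (Fin n) K (Finset.univ.sup M)) (by simp) _ (G ^ N) ?_ ω η hω h1
    hη.symm
  intro t
  have h3 := Ideal.pow_mem_of_pow_mem _ (hM t) (Finset.le_sup (f := M) (Finset.mem_univ t))
  obtain ⟨y, hy, z, hz, hyz⟩ := Submodule.mem_sup.mp h3
  obtain ⟨c, hc⟩ := Ideal.mem_span_range_iff_exists_fun.mp hy
  obtain ⟨b, hb⟩ := Ideal.mem_span_singleton'.mp hz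
  exact ⟨c, b, by rw [hc, hb, hyz]⟩

/-- extension by zero -/
def extF {m : ℕ} (ω : MForm K n m) : Finset (Fin n) → MvPolynomial (Fin n) K :=
  fun T => if h : T.card = m then ω T h else 0

theorem extF_eq {m : ℕ} (ω : MForm K n m) (T : Finset (Fin n)) (h : T.card = m) :
    extF ω T = ω T h := dif_pos h

theorem extF_ne {m : ℕ} (ω : MForm K n m) (T : Finset (Fin n)) (h : T.card ≠ m) :
    extF ω T = 0 := dif_neg h

theorem wedge_eq {m : ℕ} (g : MvPolynomial (Fin n) K) (ω : MForm K n m)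
    (x : Finset (Fin n) → MvPolynomial (Fin n) K) (hx : ∀ T h, x T = ω T h)
    (T : Finset (Fin n)) (hT : T.card = m + 1) :
    wedgeD g ω T hT = wd (fun i => pderiv i g) x T := by
  rw [wd_apply, ← Finset.sum_attach T]
  unfold wedgeD
  refine Finset.sum_congr rfl fun j _ => ?_
  rw [← hx]
  rfl

theorem wd_ext_ne {m : ℕ} (v : Fin n → MvPolynomial (Fin n) K) (ω : MForm K n m)
    (T : Finset (Fin n)) (hT : T.card ≠ m + 1) : wd v (extF ω) T = 0 := by
  rw [wd_apply]
  refine Finset.sum_eq_zero fun j hj => ?_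
  rw [extF_ne, mul_zero]
  have := Finset.card_erase_add_one hj
  omega

theorem hc_mul (v x : MvPolynomial (Fin n) K) (k : ℕ) (hv : v.IsHomogeneous k) (l : ℕ) :
    homogeneousComponent l (v * x) =
      v * (if k ≤ l then homogeneousComponent (l - k) x else 0) := by
  classical
  ext e
  rw [coeff_homogeneousComponent, coeff_mul, coeff_mul]
  have hve : ∀ e' : Fin n →₀ ℕ, coeff e' v ≠ 0 → e'.degree = k := by
    intro e' h
    by_contra h'
    exact h (hv.coeff_eq_zero h')
  split_ifs with h1 h2 h2
  · refine Finset.sum_congr rfl fun y hy => ?_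
    rw [Finset.HasAntidiagonal.mem_antidiagonal] at hy
    by_cases h3 : coeff y.1 v = 0
    · simp [h3]
    · have h4 := hve _ h3
      have h5 := congrArg Finsupp.degree hy
      rw [map_add] at h5
      rw [coeff_homogeneousComponent, if_pos (by omega)]
  · refine (Finset.sum_eq_zero fun y hy => ?_).trans (by simp)
    rw [Finset.HasAntidiagonal.mem_antidiagonal] at hy
    by_cases h3 : coeff y.1 v = 0
    · simp [h3]
    · have h4 := hve _ h3
      have h5 := congrArg Finsupp.degree hy
      rw [map_add] at h5
      omega
  · symm
    refine Finset.sum_eq_zero fun y hy => ?_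
    rw [Finset.HasAntidiagonal.mem_antidiagonal] at hy
    by_cases h3 : coeff y.1 v = 0
    · simp [h3]
    · have h4 := hve _ h3
      have h5 := congrArg Finsupp.degree hy
      rw [map_add] at h5
      rw [coeff_homogeneousComponent, if_neg (by omega), mul_zero]
  · simp

theorem homog_part (F : MvPolynomial (Fin n) K) (δ : ℕ) (hF : F.IsHomogeneous δ) (l : ℕ)
    (η : Finset (Fin n) → MvPolynomial (Fin n) K) :
    ∃ x : Finset (Fin n) → MvPolynomial (Fin n) K,
      (∀ T, (x T).IsHomogeneous (l - (δ - 1))) ∧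
      ∀ T, homogeneousComponent l (wd (fun i => pderiv i F) η T) =
        wd (fun i => pderiv i F) x T := by
  refine ⟨fun T => if δ - 1 ≤ l then homogeneousComponent (l - (δ - 1)) (η T) else 0,
    fun T => ?_, fun T => ?_⟩
  · dsimp only
    split_ifs
    · exact homogeneousComponent_isHomogeneous _ _
    · exact isHomogeneous_zero _ _ _
  · rw [wd_apply, wd_apply, map_sum]
    refine Finset.sum_congr rfl fun j _ => ?_
    have h5 : (sgK (MvPolynomial (Fin n) K) j T * pderiv j F).IsHomogeneous (δ - 1) := by
      have : sgK (MvPolynomial (Fin n) K) j T =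
          C ((-1 : K) ^ (T.filter (fun i => i < j)).card) := by
        rw [map_pow, map_neg, map_one]
        rfl
      rw [this]
      have h6 := (isHomogeneous_C (Fin n) ((-1 : K) ^ (T.filter (fun i => i < j)).card)).mul
        (hF.pderiv (i := j))
      rw [zero_add] at h6
      exact h6
    exact hc_mul _ _ _ h5 _

end Global

/-- Proposition 3.8: under Hypothesis (A), if a homogeneous `m`-form `ω` (`m < n`)
satisfies `df^(δ) ∧ ω = 0` and `df^(δ') ∧ ω = df^(δ) ∧ ξ` for some homogeneous
`m`-form `ξ`, then `ω = df^(δ) ∧ η` for some homogeneous `(m-1)`-form `η`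
(for `m = 0` the conclusion is `ω = 0`). -/
theorem statement2 {K : Type*} [Field K] [IsAlgClosed K] (p : ℕ) [CharP K p]
    (hp : p.Prime) {n : ℕ} (hn : 2 ≤ n) (f : MvPolynomial (Fin n) K) (δ δ' : ℕ)
    (hsetup : Setup δ δ' f) (hA : HypA p δ δ' f)
    (m : ℕ) (hm : m < n) (ω ξ : MForm K n m)
    (hω : ∃ l, ∀ T hT, (ω T hT).IsHomogeneous l)
    (hξ : ∃ l, ∀ T hT, (ξ T hT).IsHomogeneous l)
    (h1 : ∀ T (hT : T.card = m + 1), wedgeD (homogeneousComponent δ f) ω T hT = 0)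
    (h2 : ∀ T (hT : T.card = m + 1),
      wedgeD (homogeneousComponent δ' f) ω T hT
        = wedgeD (homogeneousComponent δ f) ξ T hT) :
    (m = 0 → ∀ T hT, ω T hT = 0) ∧
    (∀ (m' : ℕ) (hmm : m = m' + 1),
      ∃ η : MForm K n m',
        (∃ l, ∀ T hT, (η T hT).IsHomogeneous l) ∧
        ∀ T (hT : T.card = m' + 1),
          ω T (by omega) = wedgeD (homogeneousComponent δ f) η T hT) := by
  obtain ⟨hpδ, hpδ', hA⟩ := hA
  obtain ⟨l, hl⟩ := hω
  have hF : (homogeneousComponent δ f).IsHomogeneous δ := homogeneousComponent_isHomogeneous δ f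
  have hG : (homogeneousComponent δ' f).IsHomogeneous δ' := homogeneousComponent_isHomogeneous δ' f
  have hch : ∀ k : ℕ, ¬ p ∣ k → (k : K) ≠ 0 := fun k hk h =>
    hk ((CharP.cast_eq_zero_iff K p k).mp h)
  obtain ⟨η, hη⟩ := global_thm (homogeneousComponent δ f) (homogeneousComponent δ' f) δ δ' hF hG
    (hch δ hpδ) (hch δ' hpδ')
    (fun a j haj hFa hFia => by
      obtain ⟨b1, ⟨d, hd, b2⟩, b3⟩ := hA a j haj hFa hFia
      exact ⟨b1, ⟨d, hch d hd, b2⟩, b3⟩)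
    (extF ω) (extF ξ) (fun T hT => extF_ne ω T (by omega)) l
    (fun T => by
      by_cases h : T.card = m
      · rw [extF_eq ω T h]; exact hl T h
      · rw [extF_ne ω T h]; exact isHomogeneous_zero _ _ _)
    (by
      funext T
      by_cases h : T.card = m + 1
      · rw [← wedge_eq _ ω _ (extF_eq ω) T h]; exact h1 T h
      · rw [wd_ext_ne _ _ _ h]; rfl)
    (by
      funext T
      by_cases h : T.card = m + 1
      · rw [← wedge_eq _ ω _ (extF_eq ω) T h, ← wedge_eq _ ξ _ (extF_eq ξ) T h]; exact h2 T h
      · rw [wd_ext_ne _ _ _ h, wd_ext_ne _ _ _ h])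
  constructor
  · intro hm0 T hT
    have h3 := congrFun hη T
    rw [extF_eq ω T hT] at h3
    rw [h3, wd_apply]
    have : T = ∅ := Finset.card_eq_zero.mp (hT.trans hm0)
    subst this
    simp
  · intro m' hmm
    obtain ⟨x, hx, hx2⟩ := homog_part (homogeneousComponent δ f) δ hF l η
    refine ⟨fun T _ => x T, ⟨l - (δ - 1), fun T _ => hx T⟩, fun T hT => ?_⟩
    have hTm : T.card = m := by omega
    have h3 := congrFun hη T
    rw [extF_eq ω T hTm] at h3
    have h4 := homogeneousComponent_of_mem (n := l) (m := l) ((mem_homogeneousSubmodule _ _).mpr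
      (hl T hTm))
    rw [if_pos rfl, h3, hx2] at h4
    rw [wedge_eq _ _ x (fun T _ => rfl) T hT]
    exact h3.trans h4.symm

end
end

section
/- Assume Hypothesis (B). Let 0 ≤ m < n and let ω be a homogeneous polynomial differential m-form over K[x_1,…,x_n] satisfying df^(δ)∧ω = 0 and df^(δ')∧ω = df^(δ)∧ξ for some homogeneous m-form ξ. Then there exists a homogeneous (m−1)-form η such that ω = df^(δ)∧η (for m = 0 the conclusion is that ω = 0). -/
open MvPolynomial

noncomputable section

/-- sign -/
def kzS {R : Type*} [CommRing R] {n : ℕ} (j : Fin n) (T : Finset (Fin n)) : R :=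
  (-1) ^ (T.filter (fun i => i < j)).card

def kzE {R : Type*} [CommRing R] {n : ℕ} (j : Fin n) (Ω : Finset (Fin n) → R) :
    Finset (Fin n) → R := fun T => if j ∈ T then kzS j T * Ω (T.erase j) else 0

def kzI {R : Type*} [CommRing R] {n : ℕ} (j : Fin n) (Ω : Finset (Fin n) → R) :
    Finset (Fin n) → R := fun T => if j ∈ T then 0 else kzS j T * Ω (insert j T)

section
variable {R : Type*} [CommRing R] {n : ℕ}

lemma kzS_sq (j : Fin n) (T : Finset (Fin n)) : (kzS j T : R) * kzS j T = 1 := by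
  unfold kzS; rw [← pow_add, ← two_mul]; simp

lemma kzS_insert (j k : Fin n) (T : Finset (Fin n)) (hk : k ∉ T) :
    (kzS j (insert k T) : R) = (if k < j then -1 else 1) * kzS j T := by
  unfold kzS
  rw [Finset.filter_insert]
  split_ifs with h
  · rw [Finset.card_insert_of_notMem (by simp [hk]), pow_succ]; ring
  · ring

lemma kzS_insert_self (j : Fin n) (T : Finset (Fin n)) :
    (kzS j (insert j T) : R) = kzS j T := by
  unfold kzS
  rw [Finset.filter_insert]; simp

lemma kzEE (j k : Fin n) (Ω : Finset (Fin n) → R) (T : Finset (Fin n)) :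
    kzE j (kzE k Ω) T + kzE k (kzE j Ω) T = 0 := by
  unfold kzE
  by_cases hj : j ∈ T
  · by_cases hk : k ∈ T
    · by_cases hjk : j = k
      · subst hjk; simp
      · obtain ⟨U, hU1, hU2, rfl⟩ : ∃ U, j ∉ U ∧ k ∉ U ∧ T = insert j (insert k U) := by
          refine ⟨(T.erase j).erase k, by simp, by simp, ?_⟩
          rw [Finset.insert_erase (by simp [hk, Ne.symm hjk]), Finset.insert_erase hj]
        have e1 : (insert j (insert k U)).erase j = insert k U :=
          Finset.erase_insert (by simp [hjk, hU1])
        have e2 : (insert j (insert k U)).erase k = insert j U := by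
          rw [Finset.insert_comm]; exact Finset.erase_insert (by simp [Ne.symm hjk, hU2])
        have e3 : (insert k U).erase k = U := Finset.erase_insert hU2
        have e4 : (insert j U).erase j = U := Finset.erase_insert hU1
        rw [e1, e2, e3, e4]
        simp only [Finset.mem_insert_self, Finset.mem_insert, true_or, or_true, if_true]
        rw [kzS_insert_self, Finset.insert_comm j k, kzS_insert_self, kzS_insert_self,
          kzS_insert_self, kzS_insert j k U hU2, kzS_insert k j U hU1]
        rcases lt_or_gt_of_ne hjk with h | h
        · simp [h, h.le, not_lt.2 h.le]; ring
        · simp [h, h.le, not_lt.2 h.le]; ring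
    · simp [hk]
  · simp [hj]

lemma kzEI (j k : Fin n) (Ω : Finset (Fin n) → R) (T : Finset (Fin n)) :
    kzE j (kzI k Ω) T + kzI k (kzE j Ω) T = if j = k then Ω T else 0 := by
  unfold kzE kzI
  by_cases hjk : j = k
  · subst hjk
    by_cases hj : j ∈ T
    · obtain ⟨U, hU, rfl⟩ : ∃ U, j ∉ U ∧ T = insert j U :=
        ⟨T.erase j, by simp, (Finset.insert_erase hj).symm⟩
      have e4 : (insert j U).erase j = U := Finset.erase_insert hU
      simp [e4, hU, kzS_insert_self, ← mul_assoc, kzS_sq]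
    · have e4 : (insert j T).erase j = T := Finset.erase_insert hj
      simp [hj, e4, kzS_insert_self, ← mul_assoc, kzS_sq]
  · by_cases hj : j ∈ T
    · by_cases hk : k ∈ T
      · simp [hk, hjk, Ne.symm hjk]
      · obtain ⟨U, hU, rfl⟩ : ∃ U, j ∉ U ∧ T = insert j U :=
          ⟨T.erase j, by simp, (Finset.insert_erase hj).symm⟩
        have hkU : k ∉ U := fun h => hk (by simp [h])
        have e4 : (insert j U).erase j = U := Finset.erase_insert hU
        have e2 : (insert k (insert j U)).erase j = insert k U := by
          rw [Finset.insert_comm]; exact Finset.erase_insert (by simp [hjk, hU])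
        beta_reduce
        rw [e4, e2]
        simp only [hkU, hk, hjk, if_false, Finset.mem_insert_self, Finset.mem_insert, true_or, or_true,
          if_true]
        rw [Finset.insert_comm k j, kzS_insert_self, kzS_insert_self, kzS_insert j k U hkU,
          kzS_insert k j U hU]
        rcases lt_or_gt_of_ne hjk with h | h
        · simp [h, h.le, not_lt.2 h.le]; ring
        · simp [h, h.le, not_lt.2 h.le]; ring
    · simp [hj, hjk]

end

def kzD {R : Type*} [CommRing R] {n : ℕ} (u : Fin n → R) (Ω : Finset (Fin n) → R) :
    Finset (Fin n) → R := fun T => ∑ j, u j * kzE j Ω T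

def kzC {R : Type*} [CommRing R] {n : ℕ} (v : Fin n → R) (Ω : Finset (Fin n) → R) :
    Finset (Fin n) → R := fun T => ∑ j, v j * kzI j Ω T

section
variable {R : Type*} [CommRing R] {n : ℕ}

lemma kzE_sum (j : Fin n) (c : Fin n → R) (Ω : Fin n → Finset (Fin n) → R) (T) :
    kzE j (fun T => ∑ k, c k * Ω k T) T = ∑ k, c k * kzE j (Ω k) T := by
  unfold kzE; split_ifs
  · rw [Finset.mul_sum]; exact Finset.sum_congr rfl fun _ _ => by ring
  · simp

lemma kzI_sum (j : Fin n) (c : Fin n → R) (Ω : Fin n → Finset (Fin n) → R) (T) :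
    kzI j (fun T => ∑ k, c k * Ω k T) T = ∑ k, c k * kzI j (Ω k) T := by
  unfold kzI; split_ifs
  · simp
  · rw [Finset.mul_sum]; exact Finset.sum_congr rfl fun _ _ => by ring

lemma kzD_D (u v : Fin n → R) (Ω : Finset (Fin n) → R) (T) :
    kzD u (kzD v Ω) T = - kzD v (kzD u Ω) T := by
  rw [eq_neg_iff_add_eq_zero]
  unfold kzD
  simp_rw [kzE_sum, Finset.mul_sum]
  rw [Finset.sum_comm, ← Finset.sum_add_distrib]
  refine Finset.sum_eq_zero fun j _ => ?_
  rw [← Finset.sum_add_distrib]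
  refine Finset.sum_eq_zero fun k _ => ?_
  linear_combination u k * v j * kzEE k j Ω T

lemma kzD_sq (u : Fin n → R) (Ω : Finset (Fin n) → R) (T) :
    kzD u (kzD u Ω) T = 0 := by
  unfold kzD
  simp_rw [kzE_sum, Finset.mul_sum]
  rw [← Finset.sum_product']
  refine Finset.sum_involution (fun a _ => (a.2, a.1)) ?_ ?_ (by simp) (by simp)
  · rintro ⟨j, k⟩ _
    linear_combination u k * u j * kzEE k j Ω T
  · rintro ⟨j, k⟩ _ hne heq
    simp only [Prod.mk.injEq] at heq
    obtain ⟨rfl, -⟩ := heq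
    exact hne (by simp [kzE])

lemma kzD_C (u v : Fin n → R) (Ω : Finset (Fin n) → R) (T) :
    kzD u (kzC v Ω) T + kzC v (kzD u Ω) T = (∑ j, v j * u j) * Ω T := by
  unfold kzD kzC
  simp_rw [kzE_sum, kzI_sum, Finset.mul_sum]
  rw [Finset.sum_comm, ← Finset.sum_add_distrib, Finset.sum_mul]
  refine Finset.sum_congr rfl fun j _ => ?_
  rw [← Finset.sum_add_distrib]
  trans ∑ k, if k = j then v j * u k * Ω T else 0
  · refine Finset.sum_congr rfl fun k _ => ?_
    have := kzEI k j Ω T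
    split_ifs at this ⊢ with h
    · linear_combination u k * v j * this
    · linear_combination u k * v j * this
  · simp

/-- linearity -/
lemma kzD_lin (u : Fin n → R) (a b : R) (Ω Ω' : Finset (Fin n) → R) (T) :
    kzD u (fun T => a * Ω T + b * Ω' T) T = a * kzD u Ω T + b * kzD u Ω' T := by
  unfold kzD kzE
  rw [Finset.mul_sum, Finset.mul_sum, ← Finset.sum_add_distrib]
  refine Finset.sum_congr rfl fun j _ => ?_
  split_ifs <;> ring

lemma kzC_lin (u : Fin n → R) (a b : R) (Ω Ω' : Finset (Fin n) → R) (T) :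
    kzC u (fun T => a * Ω T + b * Ω' T) T = a * kzC u Ω T + b * kzC u Ω' T := by
  unfold kzC kzI
  rw [Finset.mul_sum, Finset.mul_sum, ← Finset.sum_add_distrib]
  refine Finset.sum_congr rfl fun j _ => ?_
  split_ifs <;> ring

lemma kzD_mem (Q : Ideal R) (u : Fin n → R) (Ω : Finset (Fin n) → R) (h : ∀ T, Ω T ∈ Q) (T) :
    kzD u Ω T ∈ Q := by
  refine Q.sum_mem fun j _ => Q.mul_mem_left _ ?_
  unfold kzE; split_ifs
  · exact Q.mul_mem_left _ (h _)
  · simp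

lemma kzC_mem (Q : Ideal R) (u : Fin n → R) (Ω : Finset (Fin n) → R) (h : ∀ T, Ω T ∈ Q) (T) :
    kzC u Ω T ∈ Q := by
  refine Q.sum_mem fun j _ => Q.mul_mem_left _ ?_
  unfold kzI; split_ifs
  · simp
  · exact Q.mul_mem_left _ (h _)

lemma kzC_supp (u : Fin n → R) (Ω : Finset (Fin n) → R) (d : ℕ)
    (h : ∀ T, d + 1 ≤ T.card → Ω T = 0) (T) (hT : d ≤ T.card) :
    kzC u Ω T = 0 := by
  refine Finset.sum_eq_zero fun j _ => ?_
  unfold kzI; split_ifs with hj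
  · simp
  · rw [h _ (by rw [Finset.card_insert_of_notMem hj]; omega)]; simp

theorem kz_vanish (N : ℕ) (u : Fin n → R) (h : R) (Q : ℕ → Ideal R) (y : ℕ → R)
    (hQ : ∀ k < N, Q (k+1) = Q k ⊔ Ideal.span {y k})
    (hreg : ∀ k < N, ∀ a, y k * a ∈ Q k → a ∈ Q k)
    (hy : ∀ k < N, ∃ (a : R) (v : Fin n → R), y k = a * h + ∑ j, v j * u j) :
    ∀ d k, k + d ≤ N → ∀ ω τ : Finset (Fin n) → R,
      (∀ T, d ≤ T.card → ω T = 0) → (∀ T, d ≤ T.card + 1 → τ T = 0) →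
      (∀ T, kzD u ω T ∈ Q k) → (∀ T, h * ω T - kzD u τ T ∈ Q k) →
      ∃ α β : Finset (Fin n) → R, (∀ T, ω T - kzD u α T ∈ Q k) ∧
        (∀ T, τ T - (h * α T - kzD u β T) ∈ Q k) := by
  intro d
  induction d with
  | zero =>
    intro k _ ω τ h1 h2 _ _
    refine ⟨0, 0, fun T => ?_, fun T => ?_⟩
    · rw [h1 T (by omega)]; simp [kzD, kzE]
    · rw [h2 T (by omega)]; simp [kzD, kzE]
  | succ d ih =>
    intro k hk ω τ h1 h2 h3 h4
    obtain ⟨a, v, hav⟩ := hy k (by omega)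
    set ω' : Finset (Fin n) → R := fun T => 1 * kzC v ω T + a * τ T with hω'
    set τ' : Finset (Fin n) → R := fun T => (-1) * kzC v τ T + 0 * τ T with hτ'
    have c1 : ∀ T, kzD u ω' T - y k * ω T ∈ Q k := by
      intro T
      have e1 := kzD_C u v ω T
      have m1 := kzC_mem (Q k) v _ h3 T
      have m2 := (Q k).mul_mem_left a (h4 T)
      rw [hω', kzD_lin, hav]
      have : 1 * kzD u (kzC v ω) T + a * kzD u τ T - (a * h + ∑ j, v j * u j) * ω T =
        - (kzC v (kzD u ω) T + a * (h * ω T - kzD u τ T)) := by linear_combination e1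
      rw [this]
      exact (Q k).neg_mem ((Q k).add_mem m1 m2)
    have c2 : ∀ T, h * ω' T - kzD u τ' T - y k * τ T ∈ Q k := by
      intro T
      have e1 := kzD_C u v τ T
      have m1 := kzC_mem (Q k) v (fun T => h * ω T + (-1) * kzD u τ T)
        (fun T => by convert h4 T using 1; ring) T
      rw [kzC_lin] at m1
      rw [hτ', kzD_lin, hav]
      convert m1 using 1
      simp only [hω']
      linear_combination e1
    have hQk := hQ k (by omega)
    have le1 : Q k ≤ Q (k+1) := hQk ▸ le_sup_left
    have my : y k ∈ Q (k+1) := hQk ▸ (le_sup_right : _ ≤ Q k ⊔ _) (Ideal.mem_span_singleton_self _)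
    obtain ⟨α, β, hα, hβ⟩ := ih (k+1) (by omega) ω' τ'
      (fun T hT => by
        simp only [hω']
        rw [kzC_supp v ω d h1 T hT, h2 T (by omega)]; ring)
      (fun T hT => by
        simp only [hτ']
        rcases Nat.eq_zero_or_pos d with hd | hd
        · subst hd
          have : kzC v τ T = 0 := by
            refine Finset.sum_eq_zero fun j _ => ?_
            unfold kzI; split_ifs
            · simp
            · rw [h2 _ (by omega)]; simp
          rw [this]; ring
        · obtain ⟨d, rfl⟩ : ∃ e, d = e + 1 := ⟨d - 1, by omega⟩
          rw [kzC_supp v τ d (fun T hT => h2 T (by omega)) T (by omega)]; ring)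
      (fun T => by
        have := (Q (k+1)).add_mem (le1 (c1 T)) ((Q (k+1)).mul_mem_right (ω T) my)
        simpa using this)
      (fun T => by
        have := (Q (k+1)).add_mem (le1 (c2 T)) ((Q (k+1)).mul_mem_right (τ T) my)
        simpa using this)
    have key : ∀ z ∈ Q (k+1), ∃ b, z - y k * b ∈ Q k := by
      intro z hz
      rw [hQk, Submodule.mem_sup] at hz
      obtain ⟨q, hq, w, hw, rfl⟩ := hz
      obtain ⟨b, rfl⟩ := Ideal.mem_span_singleton'.1 hw
      exact ⟨b, by convert hq using 1; ring⟩
    choose A hA using fun T => key _ (hα T)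
    choose B hB using fun T => key _ (hβ T)
    refine ⟨A, B, fun T => hreg k (by omega) _ ?_, fun T => hreg k (by omega) _ ?_⟩
    · have m := kzD_mem (Q k) u
        (fun T => 1 * (1 * ω' T + (-1) * kzD u α T) + (-(y k)) * A T)
        (fun T => by convert hA T using 1; ring) T
      rw [kzD_lin, kzD_lin] at m
      rw [kzD_sq] at m
      convert (Q k).sub_mem m (c1 T) using 1
      ring
    · have m := kzD_mem (Q k) u
        (fun T => 1 * (1 * τ' T + (-1) * (h * α T + (-1) * kzD u β T)) + (-(y k)) * B T)
        (fun T => by convert hB T using 1; ring) T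
      rw [kzD_lin, kzD_lin, kzD_lin u h (-1) α, kzD_sq] at m
      convert (Q k).sub_mem ((Q k).sub_mem ((Q k).mul_mem_left h (hA T)) m) (c2 T) using 1
      ring
end

section
variable {K : Type*} [Field K] {n : ℕ}

def kzQ (K : Type*) [Field K] (n N : ℕ) (k : ℕ) : Ideal (MvPolynomial (Fin n) K) :=
  Ideal.span ((fun s => monomial s (1 : K)) '' {s | ∃ i : Fin n, i.val < k ∧ s = Finsupp.single i N})

lemma kz_mem (N k : ℕ) (x : MvPolynomial (Fin n) K) :
    x ∈ kzQ K n N k ↔ ∀ m ∈ x.support, ∃ i : Fin n, i.val < k ∧ N ≤ m i := by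
  unfold kzQ
  rw [mem_ideal_span_monomial_image]
  refine forall₂_congr fun m _ => ?_
  constructor
  · rintro ⟨s, ⟨i, hi, rfl⟩, h⟩
    exact ⟨i, hi, by simpa using h⟩
  · rintro ⟨i, hi, h⟩
    exact ⟨_, ⟨i, hi, rfl⟩, by simpa using h⟩

def kzY (K : Type*) [Field K] (n N : ℕ) (k : ℕ) : MvPolynomial (Fin n) K :=
  if hk : k < n then X ⟨k, hk⟩ ^ N else 0

lemma kzQ_succ (N : ℕ) : ∀ k < n, kzQ K n N (k + 1) = kzQ K n N k ⊔
    Ideal.span {kzY K n N k} := by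
  intro k hk
  simp only [kzY, hk, dif_pos]
  unfold kzQ
  rw [← Ideal.span_union]
  congr 1
  ext x
  simp only [Set.mem_image, Set.mem_setOf_eq, Set.mem_union, Set.mem_singleton_iff]
  constructor
  · rintro ⟨s, ⟨i, hi, rfl⟩, rfl⟩
    rcases Nat.lt_succ_iff_lt_or_eq.1 hi with hi | hi
    · exact Or.inl ⟨_, ⟨i, hi, rfl⟩, rfl⟩
    · right; rw [X_pow_eq_monomial]
      have : i = ⟨k, hk⟩ := Fin.ext hi
      rw [this]
  · rintro (⟨s, ⟨i, hi, rfl⟩, rfl⟩ | rfl)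
    · exact ⟨_, ⟨i, by omega, rfl⟩, rfl⟩
    · exact ⟨_, ⟨⟨k, hk⟩, by simp, rfl⟩, by rw [X_pow_eq_monomial]⟩

lemma kzY_reg (N : ℕ) : ∀ k < n, ∀ a, kzY K n N k * a ∈
    kzQ K n N k → a ∈ kzQ K n N k := by
  intro k hk a ha
  simp only [kzY, hk, dif_pos] at ha
  rw [kz_mem] at ha ⊢
  intro m hm
  obtain ⟨i, hi, hle⟩ := ha (m + Finsupp.single ⟨k, hk⟩ N) (by
    rw [mem_support_iff] at hm ⊢
    rwa [X_pow_eq_monomial, add_comm, coeff_monomial_mul, one_mul])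
  refine ⟨i, hi, ?_⟩
  have : (⟨k, hk⟩ : Fin n) ≠ i := fun h => by rw [← h] at hi; simp at hi
  simpa [Finsupp.single_apply, this] using hle

theorem kz_poly (u : Fin n → MvPolynomial (Fin n) K) (h : MvPolynomial (Fin n) K) (N : ℕ)
    (hN : ∀ i, ∃ (a : MvPolynomial (Fin n) K) (v : Fin n → MvPolynomial (Fin n) K),
      X i ^ N = a * h + ∑ j, v j * u j)
    (ω τ : Finset (Fin n) → MvPolynomial (Fin n) K)
    (h1 : ∀ T, n ≤ T.card → ω T = 0) (h2 : ∀ T, n ≤ T.card + 1 → τ T = 0)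
    (h3 : ∀ T, kzD u ω T = 0) (h4 : ∀ T, h * ω T = kzD u τ T) :
    ∃ α β : Finset (Fin n) → MvPolynomial (Fin n) K, (∀ T, ω T = kzD u α T) ∧
        (∀ T, τ T = h * α T - kzD u β T) := by
  have h0 : kzQ K n N 0 = ⊥ := by unfold kzQ; simp
  have g3 : ∀ k < n, ∃ (a : MvPolynomial (Fin n) K) (v : Fin n → MvPolynomial (Fin n) K),
      kzY K n N k = a * h + ∑ j, v j * u j := by
    intro k hk
    simp only [kzY, hk, dif_pos]
    exact hN _

  obtain ⟨α, β, hα, hβ⟩ := kz_vanish n u h (kzQ K n N)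
    (kzY K n N) (kzQ_succ N) (kzY_reg N) g3 n 0 (by omega) ω τ h1 h2
    (fun T => by rw [h3]; simp) (fun T => by rw [h4]; simp)
  refine ⟨α, β, fun T => ?_, fun T => ?_⟩
  · have := hα T
    rw [h0] at this
    exact sub_eq_zero.1 this
  · have := hβ T
    rw [h0] at this
    exact sub_eq_zero.1 this

lemma hc_mul_s3 {a b : MvPolynomial (Fin n) K} {e : ℕ} (ha : a.IsHomogeneous e) (l : ℕ) :
    homogeneousComponent (l + e) (a * b) = a * homogeneousComponent l b := by
  let _ := MvPolynomial.gradedAlgebra (σ := Fin n) (R := K)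
  have := DirectSum.coe_decompose_mul_of_left_mem_of_le (homogeneousSubmodule (Fin n) K)
    (a := a) (b := b) (i := e) (n := l + e) ha (by omega)
  rw [Nat.add_sub_cancel] at this
  erw [decomposition.decompose'_apply, decomposition.decompose'_apply] at this
  exact this

lemma hc_mul_lt {a b : MvPolynomial (Fin n) K} {e : ℕ} (ha : a.IsHomogeneous e) (l : ℕ)
    (hl : l < e) : homogeneousComponent l (a * b) = 0 := by
  let _ := MvPolynomial.gradedAlgebra (σ := Fin n) (R := K)
  have := DirectSum.coe_decompose_mul_of_left_mem_of_not_le (homogeneousSubmodule (Fin n) K)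
    (a := a) (b := b) (i := e) (n := l) ha (by omega)
  erw [decomposition.decompose'_apply] at this
  exact this

lemma hc_S (j : Fin n) (T : Finset (Fin n)) (l : ℕ) (b : MvPolynomial (Fin n) K) :
    homogeneousComponent l (kzS j T * b) = kzS j T * homogeneousComponent l b := by
  unfold kzS
  rcases neg_one_pow_eq_or (MvPolynomial (Fin n) K) (T.filter (fun i => i < j)).card with h | h <;>
    rw [h] <;> simp

def kzP (c l : ℕ) (Ω : Finset (Fin n) → MvPolynomial (Fin n) K) :
    Finset (Fin n) → MvPolynomial (Fin n) K :=
  fun T => if T.card = c then homogeneousComponent l (Ω T) else 0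

lemma kzP_D (u : Fin n → MvPolynomial (Fin n) K) (e : ℕ) (hu : ∀ j, (u j).IsHomogeneous e)
    (c l : ℕ) (Ω : Finset (Fin n) → MvPolynomial (Fin n) K) (T) :
    kzP (c + 1) (l + e) (kzD u Ω) T = kzD u (kzP c l Ω) T := by
  unfold kzP kzD
  split_ifs with hT
  · rw [map_sum]
    refine Finset.sum_congr rfl fun j _ => ?_
    rw [hc_mul_s3 (hu j)]
    unfold kzE
    beta_reduce
    by_cases hj : j ∈ T
    · rw [if_pos hj, if_pos hj, hc_S]
      rw [if_pos (by rw [Finset.card_erase_of_mem hj]; omega)]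
    · simp [hj]
  · refine (Finset.sum_eq_zero fun j _ => ?_).symm
    unfold kzE
    beta_reduce
    split_ifs with hj h2
    · rw [Finset.card_erase_of_mem hj] at h2
      have := Finset.card_pos.2 ⟨j, hj⟩
      omega
    · simp
    · simp

lemma kzP_D_lt (u : Fin n → MvPolynomial (Fin n) K) (e : ℕ) (hu : ∀ j, (u j).IsHomogeneous e)
    (c l : ℕ) (hl : l < e) (Ω : Finset (Fin n) → MvPolynomial (Fin n) K) (T) :
    kzP c l (kzD u Ω) T = 0 := by
  unfold kzP kzD
  split_ifs with hT
  · rw [map_sum]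
    exact Finset.sum_eq_zero fun j _ => hc_mul_lt (hu j) l hl
  · rfl

lemma kzP_D_zero (u : Fin n → MvPolynomial (Fin n) K)
    (l : ℕ) (Ω : Finset (Fin n) → MvPolynomial (Fin n) K) (T) :
    kzP 0 l (kzD u Ω) T = 0 := by
  unfold kzP kzD
  split_ifs with hT
  · rw [Finset.card_eq_zero] at hT
    subst hT
    simp [kzE]
  · rfl

lemma kzP_D_ex (u : Fin n → MvPolynomial (Fin n) K) (e : ℕ) (hu : ∀ j, (u j).IsHomogeneous e)
    (c l : ℕ) (Ω : Finset (Fin n) → MvPolynomial (Fin n) K) :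
    ∃ β, ∀ T, kzP c l (kzD u Ω) T = kzD u β T := by
  have hz : ∀ T, kzD u 0 T = 0 := fun T => by simp [kzD, kzE]
  by_cases hl : l < e
  · exact ⟨0, fun T => by rw [kzP_D_lt u e hu c l hl, hz]⟩
  obtain ⟨l, rfl⟩ : ∃ k, l = k + e := ⟨l - e, by omega⟩
  rcases c with _ | c
  · exact ⟨0, fun T => by rw [kzP_D_zero, hz]⟩
  · exact ⟨_, fun T => kzP_D u e hu c l Ω T⟩

theorem kz_low (u : Fin n → MvPolynomial (Fin n) K) (h : MvPolynomial (Fin n) K) (N e q : ℕ)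
    (hq : 0 < q)
    (hu : ∀ j, (u j).IsHomogeneous e) (hh : h.IsHomogeneous q)
    (hN : ∀ i, ∃ (a : MvPolynomial (Fin n) K) (v : Fin n → MvPolynomial (Fin n) K),
      X i ^ N = a * h + ∑ j, v j * u j) (c : ℕ) (hc : c + 1 < n) :
    ∀ (l : ℕ) (Ω : Finset (Fin n) → MvPolynomial (Fin n) K),
    (∀ T, kzP c l Ω T = Ω T) → (∀ T, kzD u Ω T = 0) → ∃ β, ∀ T, Ω T = kzD u β T := by
  have hz : ∀ T, kzD u 0 T = 0 := fun T => by simp [kzD, kzE]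
  intro l
  induction l using Nat.strong_induction_on with
  | _ l ih =>
  intro Ω hP hD
  obtain ⟨α, β, hα, hβ⟩ := kz_poly u h N hN 0 Ω (fun _ _ => rfl)
    (fun T hT => by rw [← hP T, kzP, if_neg (by omega)]) hz
    (fun T => by rw [hD]; simp)
  obtain ⟨β', hβ'⟩ := kzP_D_ex u e hu c l β
  have hβ2 : ∀ T, kzP c l (fun T => h * α T) T = Ω T + kzD u β' T := by
    intro T
    rw [← hβ' T, ← hP T]
    unfold kzP
    split_ifs
    · rw [← map_add]; congr 1; rw [hβ T]; ring
    · simp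
  by_cases hl : l < q
  · refine ⟨fun T => (-1) * β' T + 0 * β' T, fun T => ?_⟩
    rw [kzD_lin]
    have := hβ2 T
    unfold kzP at this
    split_ifs at this
    · rw [hc_mul_lt hh l hl] at this
      linear_combination -this
    · linear_combination -this
  · obtain ⟨l, rfl⟩ : ∃ k, l = k + q := ⟨l - q, by omega⟩
    obtain ⟨γ, hγ⟩ := ih l (by omega) (kzP c l α)
      (fun T => by
        unfold kzP; split_ifs
        · exact (homogeneousComponent_of_mem (homogeneousComponent_mem l _)).trans (by simp)
        · rfl)
      (fun T => by
        rw [← kzP_D u e hu]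
        unfold kzP; split_ifs
        · rw [← hα T]; simp
        · rfl)
    refine ⟨fun T => h * γ T + (-1) * β' T, fun T => ?_⟩
    rw [kzD_lin, ← hγ T]
    have := hβ2 T
    have h5 : kzP c (l + q) (fun T => h * α T) T = h * kzP c l α T := by
      unfold kzP; split_ifs
      · rw [hc_mul_s3 hh]
      · simp
    rw [h5] at this
    linear_combination -this

lemma kzC_P (c l : ℕ) (Ω : Finset (Fin n) → MvPolynomial (Fin n) K)
    (hP : ∀ T, kzP (c + 1) l Ω T = Ω T) (T) :
    kzP c (l + 1) (kzC X Ω) T = kzC X Ω T := by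
  unfold kzP kzC
  split_ifs with hT
  · rw [map_sum]
    refine Finset.sum_congr rfl fun j _ => ?_
    rw [hc_mul_s3 (isHomogeneous_X K j)]
    unfold kzI
    split_ifs with hj
    · simp
    · rw [hc_S]
      have := hP (insert j T)
      unfold kzP at this
      rw [if_pos (by rw [Finset.card_insert_of_notMem hj, hT])] at this
      rw [this]
  · refine (Finset.sum_eq_zero fun j _ => ?_).symm
    unfold kzI
    split_ifs with hj
    · simp
    · rw [← hP, kzP, if_neg (by rw [Finset.card_insert_of_notMem hj]; omega)]; simp

theorem kz_main (u w : Fin n → MvPolynomial (Fin n) K) (h : MvPolynomial (Fin n) K) (N e q : ℕ)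
    (hq : 0 < q) (hqK : (q : K) ≠ 0)
    (hu : ∀ j, (u j).IsHomogeneous e) (hh : h.IsHomogeneous q)
    (hN : ∀ i, ∃ (a : MvPolynomial (Fin n) K) (v : Fin n → MvPolynomial (Fin n) K),
      X i ^ N = a * h + ∑ j, v j * u j)
    (hEu : ∑ j, X j * u j = 0) (hEw : ∑ j, X j * w j = C (q : K) * h)
    (c l : ℕ) (hc : c < n) (ω ξ : Finset (Fin n) → MvPolynomial (Fin n) K)
    (hP : ∀ T, kzP c l ω T = ω T)
    (hξ : ∀ T, T.card ≠ c → ξ T = 0)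
    (h1 : ∀ T, kzD u ω T = 0) (h2 : ∀ T, kzD w ω T = kzD u ξ T) :
    ∃ η, ∀ T, ω T = kzD u η T := by
  have hz : ∀ v T, kzC (R := MvPolynomial (Fin n) K) (n := n) v 0 T = 0 :=
    fun v T => by simp [kzC, kzI]
  have hzD : ∀ T, kzD u 0 T = 0 := fun T => by simp [kzD, kzE]
  have hex : ∃ β, ∀ T, kzC X ω T = kzD u β T := by
    rcases c with _ | c
    · refine ⟨0, fun T => ?_⟩
      rw [hzD]
      exact kzC_supp X ω 0 (fun T hT => by rw [← hP T, kzP, if_neg (by omega)]) T (by omega)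
    · refine kz_low u h N e q hq hu hh hN c hc (l + 1) _ (kzC_P c l ω hP) ?_
      intro T
      have := kzD_C u X ω T
      rw [hEu, show kzD u ω = 0 from funext h1, hz] at this
      simpa using this
  obtain ⟨β, hβ⟩ := hex
  have a1 : ∀ T, C (q : K) * h * ω T
      = kzD u (fun T => (-1) * kzD w β T + (-1) * kzC X ξ T) T := by
    intro T
    have e1 := kzD_C w X ω T
    have e2 := kzD_C u X ξ T
    rw [hEw, show kzC X ω = kzD u β from funext hβ, kzD_D,
      show kzD w ω = kzD u ξ from funext h2] at e1
    rw [hEu] at e2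
    rw [kzD_lin]
    linear_combination e2 - e1
  set τ := (fun T => (-1) * kzD w β T + (-1) * kzC X ξ T) with hτ
  -- restrict `τ` to the relevant degree
  have a2 : ∃ τ' : Finset (Fin n) → MvPolynomial (Fin n) K, (∀ T, n ≤ T.card + 1 → τ' T = 0) ∧
      ∀ T, h * ω T = kzD u τ' T := by
    refine ⟨fun T => if T.card + 1 = c then C (q : K)⁻¹ * τ T else 0, fun T hT => ?_, fun T => ?_⟩
    · exact if_neg (by omega)
    · by_cases hT : T.card = c
      · have : h * ω T = C (q : K)⁻¹ * kzD u τ T := by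
          rw [← a1 T]
          rw [← mul_assoc, ← mul_assoc, ← C_mul, inv_mul_cancel₀ hqK]; simp
        rw [this]
        unfold kzD
        rw [Finset.mul_sum]
        refine Finset.sum_congr rfl fun j _ => ?_
        unfold kzE
        beta_reduce
        split_ifs with hj h5
        · ring
        · rw [Finset.card_erase_of_mem hj] at h5
          have := Finset.card_pos.2 ⟨j, hj⟩
          omega
        · ring
      · rw [← hP T, kzP, if_neg hT]
        rw [mul_zero]
        refine (Finset.sum_eq_zero fun j _ => ?_).symm
        unfold kzE
        beta_reduce
        split_ifs with hj h5
        · rw [Finset.card_erase_of_mem hj] at h5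
          have := Finset.card_pos.2 ⟨j, hj⟩
          omega
        · simp
        · simp
  obtain ⟨τ', b1, b2⟩ := a2
  obtain ⟨α, -, hα, -⟩ := kz_poly u h N hN ω τ'
    (fun T hT => by rw [← hP T, kzP, if_neg (by omega)]) b1 h1 b2
  exact ⟨α, hα⟩

end

def kzTot {K : Type*} [Field K] {n m : ℕ} (ω : MForm K n m) :
    Finset (Fin n) → MvPolynomial (Fin n) K :=
  fun T => if h : T.card = m then ω T h else 0

lemma kzD_tot {K : Type*} [Field K] {n m : ℕ} (g : MvPolynomial (Fin n) K) (ω : MForm K n m)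
    (T : Finset (Fin n)) (hT : T.card = m + 1) :
    kzD (fun j => pderiv j g) (kzTot ω) T = wedgeD g ω T hT := by
  unfold kzD wedgeD
  have : ∀ j, pderiv j g * kzE j (kzTot ω) T =
      if j ∈ T then kzS j T * pderiv j g * kzTot ω (T.erase j) else 0 := by
    intro j; unfold kzE; split_ifs <;> ring
  simp_rw [this]
  rw [← Finset.sum_filter, Finset.filter_mem_eq_inter, Finset.univ_inter, ← Finset.sum_attach]
  refine Finset.sum_congr rfl fun j _ => ?_
  unfold kzTot
  rw [dif_pos (by rw [Finset.card_erase_of_mem j.2]; omega)]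
  rfl

lemma kzD_tot_ne {K : Type*} [Field K] {n m : ℕ} (u : Fin n → MvPolynomial (Fin n) K)
    (ω : MForm K n m) (T : Finset (Fin n)) (hT : T.card ≠ m + 1) :
    kzD u (kzTot ω) T = 0 := by
  refine Finset.sum_eq_zero fun j _ => ?_
  unfold kzE
  split_ifs with hj
  · have := Finset.card_pos.2 ⟨j, hj⟩
    rw [kzTot, dif_neg (by rw [Finset.card_erase_of_mem hj]; omega)]; simp
  · simp

lemma kz_null {K : Type*} [Field K] [IsAlgClosed K] {n : ℕ} (u : Fin n → MvPolynomial (Fin n) K)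
    (h : MvPolynomial (Fin n) K)
    (H : ∀ a : Fin n → K, a ≠ 0 → (∀ i, eval a (u i) = 0) → eval a h ≠ 0) :
    ∃ N : ℕ, ∀ i, ∃ (a : MvPolynomial (Fin n) K) (v : Fin n → MvPolynomial (Fin n) K),
      X i ^ N = a * h + ∑ j, v j * u j := by
  have key : ∀ i, (X i : MvPolynomial (Fin n) K) ∈
      (Ideal.span (insert h (Set.range u))).radical := by
    intro i
    rw [← vanishingIdeal_zeroLocus_eq_radical (K := K)]
    rw [mem_vanishingIdeal_iff]
    intro a ha
    rw [mem_zeroLocus_iff] at ha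
    have e1 : eval a h = 0 := by
      have := ha h (Ideal.subset_span (by simp)); simpa [aeval_eq_eval] using this
    have e2 : ∀ i, eval a (u i) = 0 := fun i => by
      have := ha (u i) (Ideal.subset_span (by simp)); simpa [aeval_eq_eval] using this
    by_cases h0 : a = 0
    · simp [h0]
    · exact absurd e1 (H a h0 e2)
  choose N hN using key
  refine ⟨∑ i, N i, fun i => ?_⟩
  have hm : (X i : MvPolynomial (Fin n) K) ^ (∑ i, N i) ∈ Ideal.span (insert h (Set.range u)) := by
    obtain ⟨r, hr⟩ := Nat.exists_eq_add_of_le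
      (Finset.single_le_sum (f := N) (fun _ _ => Nat.zero_le _) (Finset.mem_univ i))
    rw [hr, pow_add]
    exact Ideal.mul_mem_right _ _ (hN i)
  rw [Ideal.mem_span_insert] at hm
  obtain ⟨a, z, hz, e⟩ := hm
  obtain ⟨v, rfl⟩ := Ideal.mem_span_range_iff_exists_fun.1 hz
  exact ⟨a, v, e⟩

/-- Proposition 5.3: under Hypothesis (B), if a homogeneous `m`-form `ω` (`m < n`)
satisfies `df^(δ) ∧ ω = 0` and `df^(δ') ∧ ω = df^(δ) ∧ ξ` for some homogeneous
`m`-form `ξ`, then `ω = df^(δ) ∧ η` for some homogeneous `(m-1)`-form `η`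
(for `m = 0` the conclusion is `ω = 0`). -/
theorem statement3 {K : Type*} [Field K] [IsAlgClosed K] (p : ℕ) [CharP K p]
    (hp : p.Prime) {n : ℕ} (hn : 2 ≤ n) (f : MvPolynomial (Fin n) K) (δ δ' : ℕ)
    (hsetup : Setup δ δ' f) (hB : HypB p δ δ' f)
    (m : ℕ) (hm : m < n) (ω ξ : MForm K n m)
    (hω : ∃ l, ∀ T hT, (ω T hT).IsHomogeneous l)
    (hξ : ∃ l, ∀ T hT, (ξ T hT).IsHomogeneous l)
    (h1 : ∀ T (hT : T.card = m + 1), wedgeD (homogeneousComponent δ f) ω T hT = 0)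
    (h2 : ∀ T (hT : T.card = m + 1),
      wedgeD (homogeneousComponent δ' f) ω T hT
        = wedgeD (homogeneousComponent δ f) ξ T hT) :
    (m = 0 → ∀ T hT, ω T hT = 0) ∧
    (∀ (m' : ℕ) (hmm : m = m' + 1),
      ∃ η : MForm K n m',
        (∃ l, ∀ T hT, (η T hT).IsHomogeneous l) ∧
        ∀ T (hT : T.card = m' + 1),
          ω T (by omega) = wedgeD (homogeneousComponent δ f) η T hT) := by
  obtain ⟨-, hδ2, hδ'1, -, -, -⟩ := hsetup
  obtain ⟨hpδ, hpδ', -, -, hH⟩ := hB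
  have hgH := homogeneousComponent_isHomogeneous δ f
  have hhH := homogeneousComponent_isHomogeneous δ' f
  set g := homogeneousComponent δ f
  set h := homogeneousComponent δ' f
  obtain ⟨N, hN⟩ := kz_null (fun j => pderiv j g) h hH
  obtain ⟨l, hl⟩ := hω
  have hu : ∀ j, (pderiv j g).IsHomogeneous (δ - 1) := fun j => hgH.pderiv
  have hP : ∀ T, kzP m l (kzTot ω) T = kzTot ω T := by
    intro T
    unfold kzP kzTot
    split_ifs with hT
    · exact (homogeneousComponent_of_mem (hl T hT)).trans (by simp)
    · rfl
  obtain ⟨η, hη⟩ := kz_main (fun j => pderiv j g) (fun j => pderiv j h) h N (δ - 1) δ' hδ'1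
    (fun h0 => hpδ' ((CharP.cast_eq_zero_iff K p δ').1 h0)) hu hhH hN
    (by
      rw [hgH.sum_X_mul_pderiv, ← Nat.cast_smul_eq_nsmul K,
        (CharP.cast_eq_zero_iff K p δ).2 hpδ, zero_smul])
    (by rw [hhH.sum_X_mul_pderiv, ← Nat.cast_smul_eq_nsmul K, smul_eq_C_mul])
    m l hm (kzTot ω) (kzTot ξ) hP (fun T hT => dif_neg hT)
    (fun T => by
      by_cases hT : T.card = m + 1
      · rw [kzD_tot g ω T hT, h1]
      · exact kzD_tot_ne _ ω T hT)
    (fun T => by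
      by_cases hT : T.card = m + 1
      · rw [kzD_tot g ξ T hT, kzD_tot h ω T hT, h2]
      · rw [kzD_tot_ne _ ω T hT, kzD_tot_ne _ ξ T hT])
  have hη' : ∀ T, kzTot ω T = kzP m l (kzD (fun j => pderiv j g) η) T := fun T => by
    rw [← hP T, show kzTot ω = kzD (fun j => pderiv j g) η from funext hη]
  constructor
  · rintro rfl T hT
    have := hη' T
    rw [kzP_D_zero, kzTot, dif_pos hT] at this
    exact this
  · rintro m' rfl
    by_cases hle : l < δ - 1
    · refine ⟨fun _ _ => 0, ⟨0, fun _ _ => isHomogeneous_zero _ _ _⟩, fun T hT => ?_⟩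
      have := hη' T
      rw [kzP_D_lt _ _ hu _ _ hle, kzTot, dif_pos hT] at this
      rw [this]
      simp [wedgeD]
    · obtain ⟨k, rfl⟩ : ∃ k, l = k + (δ - 1) := ⟨l - (δ - 1), by omega⟩
      refine ⟨fun T _ => homogeneousComponent k (η T),
        ⟨k, fun T _ => homogeneousComponent_isHomogeneous k _⟩, fun T hT => ?_⟩
      have := hη' T
      rw [kzP_D _ _ hu, kzTot, dif_pos hT] at this
      rw [this, ← kzD_tot]
      rfl

end
end

section
/- Let f ∈ K[x_1,…,x_n] with f(0) = 0, suppose the origin is an isolated critical point of f, and suppose the singularity at the origin is weighted homogeneous: K[[x_1,…,x_n]]/(f) is isomorphic as a K-algebra to K[[x_1,…,x_n]]/(g) for some weighted homogeneous polynomial g of total degree d; if char K = p > 0, assume p does not divide d. Then f lies in the ideal generated by ∂f/∂x_1,…,∂f/∂x_n in the local ring K[x_1,…,x_n]_m, where m = (x_1,…,x_n). -/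
open MvPolynomial

noncomputable section

section PowerSeriesHelpers

variable {K : Type*} [Field K] {n : ℕ}

/-- The ideal of power series of order at least `k`. -/
def FF (K : Type*) [Field K] (n k : ℕ) : Ideal (MvPowerSeries (Fin n) K) where
  carrier := {a | ∀ e : Fin n →₀ ℕ, e.degree < k → MvPowerSeries.coeff e a = 0}
  zero_mem' := by intro e _; simp
  add_mem' := by
    intro a b ha hb e he
    rw [map_add, ha e he, hb e he, add_zero]
  smul_mem' := by
    intro c a ha e he
    classical
    rw [smul_eq_mul, MvPowerSeries.coeff_mul]
    refine Finset.sum_eq_zero fun x hx => ?_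
    rw [Finset.HasAntidiagonal.mem_antidiagonal] at hx
    rw [ha x.2 (by rw [← hx, map_add] at he; omega), mul_zero]

lemma mem_FF {k : ℕ} {a : MvPowerSeries (Fin n) K} :
    a ∈ FF K n k ↔ ∀ e : Fin n →₀ ℕ, e.degree < k → MvPowerSeries.coeff e a = 0 := Iff.rfl

lemma FF_zero (a : MvPowerSeries (Fin n) K) : a ∈ FF K n 0 := by
  intro e he; omega

lemma FF_anti {j k : ℕ} (h : j ≤ k) {a : MvPowerSeries (Fin n) K} (ha : a ∈ FF K n k) :
    a ∈ FF K n j := fun e he => ha e (by omega)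

lemma FF_mul {j k : ℕ} {a b : MvPowerSeries (Fin n) K} (ha : a ∈ FF K n j) (hb : b ∈ FF K n k) :
    a * b ∈ FF K n (j + k) := by
  classical
  intro e he
  rw [MvPowerSeries.coeff_mul]
  refine Finset.sum_eq_zero fun x hx => ?_
  rw [Finset.HasAntidiagonal.mem_antidiagonal] at hx
  rw [← hx, map_add] at he
  by_cases h : x.1.degree < j
  · rw [ha _ h, zero_mul]
  · rw [hb _ (by omega), mul_zero]

lemma mem_FF_one {a : MvPowerSeries (Fin n) K} :
    a ∈ FF K n 1 ↔ MvPowerSeries.constantCoeff a = 0 := by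
  rw [mem_FF]
  constructor
  · intro h
    simpa using h 0 (by simp)
  · intro h e he
    have : e = 0 := by
      rw [Nat.lt_one_iff] at he
      exact (Finsupp.degree_eq_zero_iff e).1 he
    subst this
    simpa using h

lemma FF_sep {a : MvPowerSeries (Fin n) K} (h : ∀ k, a ∈ FF K n k) : a = 0 := by
  ext e
  simpa using h (e.degree + 1) e (by omega)

lemma X_mem_FF (i : Fin n) : (MvPowerSeries.X i : MvPowerSeries (Fin n) K) ∈ FF K n 1 := by
  rw [mem_FF_one]; simp

/-- Elements of order at least `k+1` are combinations of the variables with coefficients of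
order at least `k`. -/
lemma FF_decomp {k : ℕ} {a : MvPowerSeries (Fin n) K} (ha : a ∈ FF K n (k + 1)) :
    ∃ b : Fin n → MvPowerSeries (Fin n) K, (∀ i, b i ∈ FF K n k) ∧
      a = ∑ i, MvPowerSeries.X i * b i := by
  classical
  let P : Fin n → (Fin n →₀ ℕ) → Prop := fun i e => e i ≠ 0 ∧ ∀ j < i, e j = 0
  let b : Fin n → MvPowerSeries (Fin n) K := fun i e =>
    if P i (e + Finsupp.single i 1) then MvPowerSeries.coeff (e + Finsupp.single i 1) a else 0
  have hb : ∀ i e, MvPowerSeries.coeff e (b i) =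
    if P i (e + Finsupp.single i 1) then MvPowerSeries.coeff (e + Finsupp.single i 1) a else 0 :=
    fun i e => rfl
  refine ⟨b, ?_, ?_⟩
  · intro i e he
    rw [hb]
    split_ifs
    · exact ha _ (by rw [map_add, Finsupp.degree_single]; omega)
    · rfl
  · ext e
    have key : ∀ i, MvPowerSeries.coeff e (MvPowerSeries.X i * b i) =
        if P i e then MvPowerSeries.coeff e a else 0 := by
      intro i
      rw [MvPowerSeries.X_def, MvPowerSeries.coeff_monomial_mul]
      by_cases h : Finsupp.single i 1 ≤ e
      · rw [if_pos h, hb, tsub_add_cancel_of_le h, one_mul]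
      · rw [if_neg h, if_neg]
        intro hP
        apply h
        rw [Finsupp.single_le_iff]
        have := hP.1
        omega
    rw [map_sum, Finset.sum_congr rfl fun i _ => key i]
    by_cases he : e = 0
    · subst he
      rw [ha 0 (by simp)]
      simp
    · have hne : (Finset.univ.filter fun i => e i ≠ 0).Nonempty := by
        obtain ⟨i, hi⟩ := Finsupp.ne_iff.1 he
        exact ⟨i, by simpa using hi⟩
      set i0 := (Finset.univ.filter fun i => e i ≠ 0).min' hne with hi0
      have h0 : e i0 ≠ 0 := by
        have := Finset.min'_mem _ hne
        simpa using this
      have h1 : ∀ j, e j ≠ 0 → i0 ≤ j := fun j hj => Finset.min'_le _ _ (by simpa using hj)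
      rw [Finset.sum_eq_single i0]
      · rw [if_pos]
        refine ⟨h0, fun j hj => ?_⟩
        by_contra hc
        exact absurd (h1 j hc) (not_le.2 hj)
      · intro j _ hj
        rw [if_neg]
        rintro ⟨h2, h3⟩
        have := h1 j h2
        exact h0 (h3 i0 (lt_of_le_of_ne this (Ne.symm hj)))
      · simp

lemma sub_C_mem (a : MvPowerSeries (Fin n) K) :
    a - algebraMap K _ (MvPowerSeries.constantCoeff a) ∈ FF K n 1 := by
  rw [mem_FF_one, map_sub, ← MvPowerSeries.c_eq_algebraMap]; simp

/-- Algebra homomorphisms out of the power series ring to an algebra where the images of the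
variables have zero products are determined by the images of the variables. -/
lemma algHom_ext_sq {S : Type*} [CommRing S] [Algebra K S]
    (A B : MvPowerSeries (Fin n) K →ₐ[K] S)
    (h : ∀ i, A (MvPowerSeries.X i) = B (MvPowerSeries.X i))
    (h2 : ∀ i j, A (MvPowerSeries.X i) * A (MvPowerSeries.X j) = 0)
    (a : MvPowerSeries (Fin n) K) : A a = B a := by
  have aux : ∀ (C : MvPowerSeries (Fin n) K →ₐ[K] S),
      (∀ i, A (MvPowerSeries.X i) = C (MvPowerSeries.X i)) → ∀ i, ∀ b ∈ FF K n 1,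
      C (MvPowerSeries.X i) * C b = 0 := by
    intro C hC i b hb
    obtain ⟨c, -, rfl⟩ := FF_decomp hb
    rw [map_sum, Finset.mul_sum]
    refine Finset.sum_eq_zero fun j _ => ?_
    rw [map_mul, ← mul_assoc, ← hC, ← hC, h2, zero_mul]
  have main : ∀ a ∈ FF K n 1, A a = B a := by
    intro a ha
    obtain ⟨c, -, rfl⟩ := FF_decomp ha
    rw [map_sum, map_sum]
    refine Finset.sum_congr rfl fun j _ => ?_
    rw [map_mul, map_mul]
    have e1 := aux A (fun _ => rfl) j _ (sub_C_mem (c j))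
    have e2 := aux B h j _ (sub_C_mem (c j))
    rw [map_sub, AlgHom.commutes, mul_sub, sub_eq_zero] at e1 e2
    rw [e1, e2, h]
  have := main _ (sub_C_mem a)
  simpa [map_sub, AlgHom.commutes] using this

section Sigma

variable (s : MvPowerSeries (Fin n) K →ₐ[K] MvPowerSeries (Fin n) K)

/-- A homomorphism sending variables to series without constant term respects the order
filtration. -/
lemma map_FF (hs : ∀ i, s (MvPowerSeries.X i) ∈ FF K n 1) (k : ℕ) :
    ∀ a ∈ FF K n k, s a ∈ FF K n k := by
  induction k with
  | zero => intro a _; exact FF_zero _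
  | succ k ih =>
    intro a ha
    obtain ⟨b, hb, rfl⟩ := FF_decomp ha
    rw [map_sum]
    refine Ideal.sum_mem _ fun i _ => ?_
    rw [map_mul, add_comm k 1]
    exact FF_mul (hs i) (ih _ (hb i))

lemma sX_mem (hs : ∀ i, s (MvPowerSeries.X i) - MvPowerSeries.X i ∈ FF K n 2)
    (i : Fin n) : s (MvPowerSeries.X i) ∈ FF K n 1 := by
  have := Ideal.add_mem _ (FF_anti (by norm_num : 1 ≤ 2) (hs i)) (X_mem_FF i)
  simpa using this

lemma sub_FF (hs : ∀ i, s (MvPowerSeries.X i) - MvPowerSeries.X i ∈ FF K n 2)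
    (k : ℕ) : ∀ a ∈ FF K n k, s a - a ∈ FF K n (k + 1) := by
  induction k with
  | zero =>
    intro a _
    have h1 := map_FF s (sX_mem s hs) 1 _ (sub_C_mem a)
    rw [map_sub, AlgHom.commutes] at h1
    have := Ideal.sub_mem _ h1 (sub_C_mem a)
    simpa using this
  | succ k ih =>
    intro a ha
    obtain ⟨b, hb, rfl⟩ := FF_decomp ha
    rw [map_sum, ← Finset.sum_sub_distrib]
    refine Ideal.sum_mem _ fun i _ => ?_
    have e : s (MvPowerSeries.X i * b i) - MvPowerSeries.X i * b i =
      (s (MvPowerSeries.X i) - MvPowerSeries.X i) * s (b i) +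
        MvPowerSeries.X i * (s (b i) - b i) := by
      rw [map_mul]; ring
    rw [e]
    refine Ideal.add_mem _ ?_ ?_
    · rw [show k + 1 + 1 = 2 + k by ring]
      exact FF_mul (hs i) (map_FF s (sX_mem s hs) _ _ (hb i))
    · rw [show k + 1 + 1 = 1 + (k + 1) by ring]
      exact FF_mul (X_mem_FF i) (ih _ (hb i))

lemma sigma_inj (hs : ∀ i, s (MvPowerSeries.X i) - MvPowerSeries.X i ∈ FF K n 2)
    : Function.Injective s := by
  rw [injective_iff_map_eq_zero]
  intro a ha
  apply FF_sep
  intro k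
  induction k with
  | zero => exact FF_zero _
  | succ k ih =>
    have := sub_FF s hs k a ih
    rw [ha, zero_sub] at this
    simpa using this

lemma sigma_surj (hs : ∀ i, s (MvPowerSeries.X i) - MvPowerSeries.X i ∈ FF K n 2)
    : Function.Surjective s := by
  intro b
  let A : ℕ → MvPowerSeries (Fin n) K := fun k => Nat.rec 0 (fun _ a => a + (b - s a)) k
  have hA : ∀ k, A (k + 1) = A k + (b - s (A k)) := fun k => rfl
  have h1 : ∀ k, b - s (A k) ∈ FF K n k := by
    intro k
    induction k with
    | zero => exact FF_zero _
    | succ k ih =>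
      have := sub_FF s hs k _ ih
      rw [← neg_mem_iff] at this
      rw [hA, map_add]
      convert this using 1
      ring
  have h2 : ∀ k j, A (k + j) - A k ∈ FF K n k := by
    intro k j
    induction j with
    | zero => simp
    | succ j ih =>
      have := Ideal.add_mem _ ih (FF_anti (Nat.le_add_right k j) (h1 (k + j)))
      rw [← add_assoc, hA]
      convert this using 1
      ring
  let a : MvPowerSeries (Fin n) K := fun e => MvPowerSeries.coeff e (A (e.degree + 1))
  have ha : ∀ e, MvPowerSeries.coeff e a = MvPowerSeries.coeff e (A (e.degree + 1)) :=
    fun _ => rfl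
  have h3 : ∀ k, a - A k ∈ FF K n k := by
    intro k e he
    obtain ⟨j, rfl⟩ := Nat.exists_eq_add_of_le (Nat.succ_le_of_lt he)
    have := h2 (e.degree + 1) j e (by omega)
    rw [map_sub] at this ⊢
    rw [ha, ← sub_eq_zero.1 this, Nat.succ_eq_add_one, sub_self]
  refine ⟨a, ?_⟩
  rw [← sub_eq_zero]
  apply FF_sep
  intro k
  have := Ideal.sub_mem _ (map_FF s (sX_mem s hs) k _ (h3 k)) (h1 k)
  rw [map_sub] at this
  convert this using 1
  ring

end Sigma

end PowerSeriesHelpers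

section MainPS

variable {K : Type*} [Field K] {n : ℕ}

lemma algHom_coe_ext {S : Type*} [CommRing S] [Algebra K S]
    (A B : MvPowerSeries (Fin n) K →ₐ[K] S)
    (h : ∀ i, A (MvPowerSeries.X i) = B (MvPowerSeries.X i)) (p : MvPolynomial (Fin n) K) :
    A (p : MvPowerSeries (Fin n) K) = B (p : MvPowerSeries (Fin n) K) := by
  have : A.comp (MvPolynomial.coeToMvPowerSeries.algHom K) =
      B.comp (MvPolynomial.coeToMvPowerSeries.algHom K) := by
    apply MvPolynomial.algHom_ext
    intro i
    simpa using h i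
  simpa using DFunLike.congr_fun this p

lemma isUnit_of_not_mem {a : MvPowerSeries (Fin n) K} (h : a ∉ FF K n 1) : IsUnit a := by
  rw [MvPowerSeries.isUnit_iff_constantCoeff]
  rw [mem_FF_one] at h
  exact isUnit_iff_ne_zero.2 h

lemma FF_one_ne_top : (1 : MvPowerSeries (Fin n) K) ∉ FF K n 1 := by
  rw [mem_FF_one]; simp

/-- An isomorphism of quotients by series without constant term sends variables to classes of
series without constant term. -/
lemma lift_mem {f g : MvPowerSeries (Fin n) K} (hf : f ∈ FF K n 1)
    (th : (MvPowerSeries (Fin n) K ⧸ Ideal.span {f}) ≃ₐ[K]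
      MvPowerSeries (Fin n) K ⧸ Ideal.span {g}) (x y : MvPowerSeries (Fin n) K)
    (hx : x ∈ FF K n 1) (h : Ideal.Quotient.mk _ y = th (Ideal.Quotient.mk _ x)) :
    y ∈ FF K n 1 := by
  by_contra hy
  have hu : IsUnit (th (Ideal.Quotient.mk _ x)) := by
    rw [← h]; exact (isUnit_of_not_mem hy).map _
  have hu2 : IsUnit (Ideal.Quotient.mk (Ideal.span {f}) x) := by
    simpa using hu.map th.symm
  obtain ⟨z, hz⟩ := hu2.exists_right_inv
  obtain ⟨z, rfl⟩ := Ideal.Quotient.mk_surjective z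
  rw [← map_mul, ← map_one (Ideal.Quotient.mk _), Ideal.Quotient.eq, Ideal.mem_span_singleton] at hz
  obtain ⟨w, hw⟩ := hz
  apply FF_one_ne_top (K := K) (n := n)
  have e : (1 : MvPowerSeries (Fin n) K) = x * z - f * w := by rw [← hw]; ring
  rw [e]
  exact Ideal.sub_mem _ (Ideal.mul_mem_right _ _ hx) (Ideal.mul_mem_right _ _ hf)

/-- Leibniz maps are determined on polynomials by the variables. -/
lemma leibniz_poly (D : MvPowerSeries (Fin n) K →ₗ[K] MvPowerSeries (Fin n) K)
    (hD : ∀ a b, D (a * b) = D a * b + a * D b) (p : MvPolynomial (Fin n) K) :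
    D (p : MvPowerSeries (Fin n) K) =
      ∑ i, D (MvPowerSeries.X i) * ((pderiv i p : MvPolynomial (Fin n) K) :
        MvPowerSeries (Fin n) K) := by
  have h1 : D 1 = 0 := by
    have := hD 1 1
    rw [mul_one, mul_one, one_mul] at this
    simpa using this
  induction p using MvPolynomial.induction_on with
  | C a =>
    rw [MvPolynomial.coe_C, ← mul_one (MvPowerSeries.C a), ← MvPowerSeries.smul_eq_C_mul, map_smul,
      h1]
    simp
  | add p q hp hq =>
    rw [MvPolynomial.coe_add, map_add, hp, hq, ← Finset.sum_add_distrib]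
    refine Finset.sum_congr rfl fun i _ => ?_
    rw [map_add, MvPolynomial.coe_add, mul_add]
  | mul_X p j hp =>
    rw [MvPolynomial.coe_mul, hD, hp, MvPolynomial.coe_X, Finset.sum_mul]
    have : ∀ i, D (MvPowerSeries.X i) * ((pderiv i (p * X j) : MvPolynomial (Fin n) K) :
        MvPowerSeries (Fin n) K) = D (MvPowerSeries.X i) * ((pderiv i p : MvPolynomial (Fin n) K) :
        MvPowerSeries (Fin n) K) * MvPowerSeries.X j +
        (if i = j then (p : MvPowerSeries (Fin n) K) * D (MvPowerSeries.X j) else 0) := by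
      intro i
      rw [pderiv_mul, pderiv_X, MvPolynomial.coe_add, MvPolynomial.coe_mul, MvPolynomial.coe_X,
        MvPolynomial.coe_mul]
      by_cases h : i = j
      · subst h; simp; ring
      · rw [if_neg h, Pi.single_eq_of_ne (Ne.symm h)]; simp; ring
    rw [Finset.sum_congr rfl fun i _ => this i, Finset.sum_add_distrib]
    simp

/-- The weighted Euler derivation on power series. -/
def eulerD (α : Fin n → ℕ) :
    Derivation K (MvPowerSeries (Fin n) K) (MvPowerSeries (Fin n) K) :=
  ∑ i, (α i • (MvPowerSeries.X i : MvPowerSeries (Fin n) K)) • MvPowerSeries.pderiv K i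

lemma eulerD_apply (α : Fin n → ℕ) (a : MvPowerSeries (Fin n) K) :
    eulerD α a = ∑ i, (α i • (MvPowerSeries.X i : MvPowerSeries (Fin n) K)) *
      MvPowerSeries.pderiv K i a := by
  have h := map_sum (Derivation.coeFnAddMonoidHom (R := K) (A := MvPowerSeries (Fin n) K)
    (M := MvPowerSeries (Fin n) K))
    (fun i => (α i • (MvPowerSeries.X i : MvPowerSeries (Fin n) K)) • MvPowerSeries.pderiv K i)
    Finset.univ
  have h2 := congrFun h a
  rw [Finset.sum_apply] at h2
  exact h2

lemma eulerD_mem (α : Fin n → ℕ) (a : MvPowerSeries (Fin n) K) : eulerD α a ∈ FF K n 1 := by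
  rw [eulerD_apply]
  exact Ideal.sum_mem _ fun i _ => Ideal.mul_mem_right _ _ (nsmul_mem (X_mem_FF i) _)

lemma eulerD_coe (α : Fin n → ℕ) (g : MvPolynomial (Fin n) K) (d : ℕ)
    (hg : IsWeightedHomogeneous α g d) :
    eulerD α (g : MvPowerSeries (Fin n) K) = (d : MvPowerSeries (Fin n) K) * g := by
  have h := congrArg (MvPolynomial.coeToMvPowerSeries.algHom K) hg.sum_weight_X_mul_pderiv
  rw [eulerD_apply]
  simp only [map_sum, map_nsmul, map_mul, MvPolynomial.coeToMvPowerSeries.algHom_apply,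
    MvPolynomial.coe_X] at h
  simp only [MvPowerSeries.pderiv_coe, nsmul_eq_mul, mul_assoc] at h ⊢
  simpa using h

lemma exists_lift {f g : MvPowerSeries (Fin n) K} (hf : f ∈ FF K n 1)
    (th : (MvPowerSeries (Fin n) K ⧸ Ideal.span {f}) ≃ₐ[K]
      MvPowerSeries (Fin n) K ⧸ Ideal.span {g}) :
    ∃ ps : MvPowerSeries (Fin n) K →ₐ[K] MvPowerSeries (Fin n) K,
      ∀ i, ps (MvPowerSeries.X i) ∈ FF K n 1 ∧
        Ideal.Quotient.mk (Ideal.span {g}) (ps (MvPowerSeries.X i)) =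
          th (Ideal.Quotient.mk _ (MvPowerSeries.X i)) := by
  choose y hy using fun i : Fin n => Ideal.Quotient.mk_surjective
    (th (Ideal.Quotient.mk _ (MvPowerSeries.X i)))
  have hy1 : ∀ i, y i ∈ FF K n 1 := fun i => lift_mem hf th _ _ (X_mem_FF i) (hy i)
  have hsub : MvPowerSeries.HasSubst y :=
    MvPowerSeries.hasSubst_of_constantCoeff_zero fun i => mem_FF_one.1 (hy1 i)
  refine ⟨MvPowerSeries.substAlgHom hsub, fun i => ?_⟩
  rw [MvPowerSeries.substAlgHom_X]
  exact ⟨hy1 i, hy i⟩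

lemma lift_poly {f g : MvPowerSeries (Fin n) K}
    (th : (MvPowerSeries (Fin n) K ⧸ Ideal.span {f}) ≃ₐ[K]
      MvPowerSeries (Fin n) K ⧸ Ideal.span {g})
    (ps : MvPowerSeries (Fin n) K →ₐ[K] MvPowerSeries (Fin n) K)
    (h : ∀ i, Ideal.Quotient.mk (Ideal.span {g}) (ps (MvPowerSeries.X i)) =
          th (Ideal.Quotient.mk _ (MvPowerSeries.X i))) (p : MvPolynomial (Fin n) K)
    (hp : (p : MvPowerSeries (Fin n) K) = f) : g ∣ ps p := by
  have := algHom_coe_ext ((Ideal.Quotient.mkₐ K (Ideal.span {g})).comp ps)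
    ((th : _ →ₐ[K] _).comp (Ideal.Quotient.mkₐ K (Ideal.span {f}))) (fun i => by simpa using h i) p
  rw [← Ideal.mem_span_singleton, ← Ideal.Quotient.eq_zero_iff_mem]
  have h2 : Ideal.Quotient.mk (Ideal.span {f}) (p : MvPowerSeries (Fin n) K) = 0 := by
    rw [Ideal.Quotient.eq_zero_iff_mem, hp]; exact Ideal.mem_span_singleton_self f
  simpa [h2] using this

lemma main_ps (f g : MvPolynomial (Fin n) K) (hf : (f : MvPowerSeries (Fin n) K) ∈ FF K n 2)
    (α : Fin n → ℕ) (hα : ∀ i, 0 < α i) (d : ℕ) (hg : IsWeightedHomogeneous α g d)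
    (hd : (d : K) ≠ 0 ∨ d = 0)
    (th : (MvPowerSeries (Fin n) K ⧸ Ideal.span {(f : MvPowerSeries (Fin n) K)}) ≃ₐ[K]
      MvPowerSeries (Fin n) K ⧸ Ideal.span {(g : MvPowerSeries (Fin n) K)}) :
    ∃ c : Fin n → MvPowerSeries (Fin n) K, (f : MvPowerSeries (Fin n) K) =
      ∑ i, c i * ((pderiv i f : MvPolynomial (Fin n) K) : MvPowerSeries (Fin n) K) := by
  have hf1 := FF_anti (by norm_num : 1 ≤ 2) hf
  have hg1 : (g : MvPowerSeries (Fin n) K) ∈ FF K n 1 :=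
    lift_mem hf1 th 0 _ (Ideal.zero_mem _) (by
      rw [map_zero, map_zero, Ideal.Quotient.eq_zero_iff_mem]
      exact Ideal.mem_span_singleton_self _)
  obtain ⟨ps, hps⟩ := exists_lift hf1 th
  obtain ⟨ch, hch⟩ := exists_lift hg1 th.symm
  obtain ⟨w, hw⟩ := lift_poly th ps (fun i => (hps i).2) f rfl
  obtain ⟨t, ht⟩ := lift_poly th.symm ch (fun i => (hch i).2) g rfl
  -- the composite
  let s : MvPowerSeries (Fin n) K →ₐ[K] MvPowerSeries (Fin n) K := ch.comp ps
  have hle : ∀ a ∈ Ideal.span {(f : MvPowerSeries (Fin n) K)}, a ∈ FF K n 2 := by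
    intro a ha
    obtain ⟨b, rfl⟩ := Ideal.mem_span_singleton.1 ha
    exact Ideal.mul_mem_right _ _ hf
  have hs : ∀ i, s (MvPowerSeries.X i) - MvPowerSeries.X i ∈ FF K n 2 := by
    intro i
    let q : (MvPowerSeries (Fin n) K ⧸ Ideal.span {(f : MvPowerSeries (Fin n) K)}) →ₐ[K]
      MvPowerSeries (Fin n) K ⧸ FF K n 2 := Ideal.Quotient.factorₐ K hle
    have hq : ∀ a, q (Ideal.Quotient.mk _ a) = Ideal.Quotient.mk _ a := fun a => rfl
    have key := algHom_ext_sq ((Ideal.Quotient.mkₐ K (FF K n 2)).comp ch)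
      (q.comp ((th.symm : _ →ₐ[K] _).comp (Ideal.Quotient.mkₐ K
        (Ideal.span {(g : MvPowerSeries (Fin n) K)})))) ?_ ?_ (ps (MvPowerSeries.X i))
    · change Ideal.Quotient.mk _ (ch (ps (MvPowerSeries.X i))) =
        q (th.symm (Ideal.Quotient.mk _ (ps (MvPowerSeries.X i)))) at key
      rw [(hps i).2, AlgEquiv.symm_apply_apply, hq] at key
      exact (Ideal.Quotient.eq).1 key
    · intro j
      have := (hch j).2
      change Ideal.Quotient.mk _ (ch (MvPowerSeries.X j)) =
        q (th.symm (Ideal.Quotient.mk _ (MvPowerSeries.X j)))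
      rw [← this, hq]
    · intro j k
      simp only [AlgHom.comp_apply, Ideal.Quotient.mkₐ_eq_mk]
      rw [← map_mul, Ideal.Quotient.eq_zero_iff_mem]
      exact FF_mul (hch j).1 (hch k).1
  by_cases hf0 : (f : MvPowerSeries (Fin n) K) = 0
  · exact ⟨0, by simp [hf0]⟩
  have hsf : s f = f * (t * ch w) := by
    change ch (ps f) = _
    rw [hw, map_mul, ht, mul_assoc]
  rcases hd with hd | rfl
  swap
  · exfalso
    have hg0 : (g : MvPowerSeries (Fin n) K) = 0 := by
      ext e
      by_cases he : e = 0
      · subst he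
        rw [hg1 0 (by simp), map_zero]
      · rw [MvPolynomial.coeff_coe, map_zero]
        by_contra hne
        have := hg hne
        apply he
        ext i
        rw [Finsupp.weight_apply, Finsupp.sum_fintype _ _ (by simp)] at this
        have := (Finset.sum_eq_zero_iff.1 this) i (Finset.mem_univ i)
        have h3 := hα i
        simp only [smul_eq_mul, mul_eq_zero] at this
        simp only [Finsupp.coe_zero, Pi.zero_apply]
        omega
    apply hf0
    apply sigma_inj s hs
    change ch (ps f) = _
    rw [hw, hg0]; simp
  -- the unit
  have hunit : IsUnit (t * ch w) := by
    apply isUnit_of_not_mem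
    intro hmem
    apply hf0
    apply FF_sep
    intro k
    induction k with
    | zero => exact FF_zero _
    | succ k ih =>
      have h1 := sub_FF s hs k _ ih
      rw [hsf] at h1
      have := Ideal.sub_mem _ (FF_mul ih hmem) h1
      simpa using this
  obtain ⟨u, hu⟩ := hunit
  let S : MvPowerSeries (Fin n) K ≃ₐ[K] MvPowerSeries (Fin n) K :=
    AlgEquiv.ofBijective s ⟨sigma_inj s hs, sigma_surj s hs⟩
  have hS : ∀ a, S a = ch (ps a) := fun a => rfl
  let D : MvPowerSeries (Fin n) K →ₗ[K] MvPowerSeries (Fin n) K :=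
    S.symm.toLinearMap ∘ₗ ch.toLinearMap ∘ₗ (eulerD α).toLinearMap ∘ₗ ps.toLinearMap
  have hDa : ∀ a, D a = S.symm (ch (eulerD α (ps a))) := fun a => rfl
  have hSs : ∀ a, S.symm (ch (ps a)) = a := fun a => by rw [← hS, AlgEquiv.symm_apply_apply]
  have hD : ∀ a b, D (a * b) = D a * b + a * D b := by
    intro a b
    simp only [hDa, map_mul, Derivation.leibniz, smul_eq_mul, map_add, hSs]
    ring
  have hSf : S.symm f * S.symm (u : MvPowerSeries (Fin n) K) = f := by
    rw [← map_mul, hu, ← hsf]; exact hSs f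
  obtain ⟨v, hv⟩ : ∃ v, S.symm (f : MvPowerSeries (Fin n) K) = f * v := by
    refine ⟨S.symm ((u⁻¹ : (MvPowerSeries (Fin n) K)ˣ) : MvPowerSeries (Fin n) K), ?_⟩
    nth_rewrite 2 [← hSf]
    rw [mul_assoc, ← map_mul, Units.mul_inv, map_one, mul_one]
  -- order preservation of the inverse
  have hm : ∀ a ∈ FF K n 1, S.symm a ∈ FF K n 1 := by
    intro a ha
    by_contra hc
    have h1 := (isUnit_of_not_mem hc).map S
    rw [AlgEquiv.apply_symm_apply] at h1
    rw [MvPowerSeries.isUnit_iff_constantCoeff, mem_FF_one.1 ha] at h1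
    simp at h1
  set h := v * S.symm t * S.symm (ch (eulerD α w)) with hh
  have hh1 : h ∈ FF K n 1 := by
    apply Ideal.mul_mem_left
    apply hm
    exact map_FF ch (fun i => (hch i).1) 1 _ (eulerD_mem α w)
  have hDf : D f = f * ((d : MvPowerSeries (Fin n) K) + h) := by
    rw [hDa, hw, Derivation.leibniz, eulerD_coe α g d hg, smul_eq_mul, smul_eq_mul, map_add,
      map_add]
    have e1 : S.symm (ch (w * ((d : MvPowerSeries (Fin n) K) * g))) = d * f := by
      have : w * ((d : MvPowerSeries (Fin n) K) * g) = d * ps f := by rw [hw]; ring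
      rw [this, map_mul, map_mul, hSs, map_natCast, map_natCast]
    rw [e1, map_mul, map_mul, ht, map_mul, hv, hh]
    ring
  have hun : IsUnit ((d : MvPowerSeries (Fin n) K) + h) := by
    rw [MvPowerSeries.isUnit_iff_constantCoeff, map_add, mem_FF_one.1 hh1, map_natCast, add_zero]
    exact isUnit_iff_ne_zero.2 hd
  obtain ⟨z, hz⟩ := hun.exists_right_inv
  refine ⟨fun i => z * D (MvPowerSeries.X i), ?_⟩
  have e := leibniz_poly D hD f
  rw [hDf] at e
  calc (f : MvPowerSeries (Fin n) K) = z * (f * ((d : MvPowerSeries (Fin n) K) + h)) := by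
        rw [mul_left_comm, mul_comm z, hz, mul_one]
    _ = _ := by
        rw [e, Finset.mul_sum]
        exact Finset.sum_congr rfl fun i _ => by ring

end MainPS

section Descend

variable {K : Type*} [Field K] {n : ℕ}

lemma box_mem (N : ℕ)
    (p : MvPolynomial (Fin n) K)
    (hp : ∀ e : Fin n →₀ ℕ, (∀ i, e i < N) → coeff e p = 0)
    (L : Type*) [CommRing L] [Algebra (MvPolynomial (Fin n) K) L] (J : Ideal L)
    (hJ : ∀ i, algebraMap (MvPolynomial (Fin n) K) L (X i ^ N) ∈ J) :
    algebraMap (MvPolynomial (Fin n) K) L p ∈ J := by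
  rw [p.as_sum, map_sum]
  refine Ideal.sum_mem _ fun e he => ?_
  obtain ⟨i, hi⟩ : ∃ i, N ≤ e i := by
    by_contra hc
    push Not at hc
    exact (MvPolynomial.mem_support_iff.1 he) (hp e hc)
  have : monomial e (coeff e p) = monomial (e - Finsupp.single i N) (coeff e p) * X i ^ N := by
    rw [MvPolynomial.X_pow_eq_monomial, MvPolynomial.monomial_mul, mul_one,
      tsub_add_cancel_of_le (Finsupp.single_le_iff.2 hi)]
  rw [this, map_mul]
  exact Ideal.mul_mem_left _ _ (hJ i)

end Descend

/-- Lemma 2.5 (first assertion): if the origin is an isolated critical point of `f`,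
`f(0) = 0`, the singularity is weighted homogeneous of total degree `d`, and the
characteristic (if positive) does not divide `d`, then `f` lies in the ideal generated
by its partial derivatives in the local ring at the origin. -/
theorem statement4 {K : Type*} [Field K] [IsAlgClosed K] {n : ℕ}
    (f : MvPolynomial (Fin n) K)
    (hf0 : eval (0 : Fin n → K) f = 0)
    (hiso : IsIsolatedCriticalAtZero f)
    (d : ℕ) (hwh : WeightedHomogSing f d)
    (hd : 0 < ringChar K → ¬ (ringChar K ∣ d)) :
    algebraMap (MvPolynomial (Fin n) K) (LocAt K (0 : Fin n → K)) f ∈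
      Ideal.span (Set.range fun i =>
        algebraMap (MvPolynomial (Fin n) K) (LocAt K (0 : Fin n → K)) (pderiv i f)) := by
  classical
  obtain ⟨hcrit, u, hu0, hu⟩ := hiso
  obtain ⟨g, ⟨α, hα, -, hg⟩, ⟨th⟩⟩ := hwh
  have hd' : (d : K) ≠ 0 ∨ d = 0 := by
    by_cases h0 : (d : K) = 0
    · right
      have hdvd := (ringChar.spec K d).1 h0
      rcases Nat.eq_zero_or_pos (ringChar K) with h1 | h1
      · rw [h1] at hdvd
        exact Nat.eq_zero_of_zero_dvd hdvd
      · exact absurd hdvd (hd h1)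
    · exact Or.inl h0
  have hev : ∀ p : MvPolynomial (Fin n) K, eval (0 : Fin n → K) p = coeff 0 p := by
    intro p
    rw [← MvPolynomial.constantCoeff_eq, ← MvPolynomial.eval_zero]
  have hf2 : (f : MvPowerSeries (Fin n) K) ∈ FF K n 2 := by
    intro e he
    rw [MvPolynomial.coeff_coe]
    have h2 : e.degree = 0 ∨ e.degree = 1 := by omega
    rcases h2 with h2 | h2
    · rw [(Finsupp.degree_eq_zero_iff e).1 h2, ← hev, hf0]
    · obtain ⟨i, rfl⟩ := (Finsupp.sum_eq_one_iff e).1 h2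
      have := hcrit i
      rw [hev, MvPolynomial.coeff_pderiv] at this
      simpa using this
  obtain ⟨c, hc⟩ := main_ps f g hf2 α hα d hg hd' th
  set J := Ideal.span (Set.range fun i =>
    algebraMap (MvPolynomial (Fin n) K) (LocAt K (0 : Fin n → K)) (pderiv i f)) with hJdef
  -- powers of variables
  have hX : ∀ i, ∃ N, algebraMap (MvPolynomial (Fin n) K) (LocAt K (0 : Fin n → K)) (X i ^ N) ∈ J := by
    intro i
    let I : Ideal (MvPolynomial (Fin n) K) := Ideal.span (Set.range fun i => pderiv i f)
    have hmem : X i * u ∈ I.radical := by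
      rw [← MvPolynomial.vanishingIdeal_zeroLocus_eq_radical (K := K), mem_vanishingIdeal_iff]
      intro y hy
      rw [MvPolynomial.mem_zeroLocus_iff] at hy
      change eval y (X i * u) = 0
      rw [map_mul, eval_X]
      by_cases hyu : eval y u = 0
      · rw [hyu, mul_zero]
      · have := hu y hyu (fun j => by
          exact hy _ (Ideal.subset_span ⟨j, rfl⟩))
        rw [this]; simp
    obtain ⟨N, hN⟩ := hmem
    refine ⟨N, ?_⟩
    have h1 : algebraMap (MvPolynomial (Fin n) K) (LocAt K (0 : Fin n → K)) ((X i * u) ^ N) ∈ J := by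
      have : I.map (algebraMap (MvPolynomial (Fin n) K) (LocAt K (0 : Fin n → K))) = J := by
        rw [Ideal.map_span, ← Set.range_comp]; rfl
      rw [← this]
      exact Ideal.mem_map_of_mem _ hN
    have hun : IsUnit (algebraMap (MvPolynomial (Fin n) K) (LocAt K (0 : Fin n → K)) (u ^ N)) := by
      apply IsLocalization.map_units _
        (⟨u ^ N, ?_⟩ : (RingHom.ker (eval (0 : Fin n → K))).primeCompl)
      change ¬ (u ^ N ∈ RingHom.ker (eval (0 : Fin n → K)))
      rw [RingHom.mem_ker, map_pow]
      exact pow_ne_zero _ hu0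
    rw [mul_pow, map_mul] at h1
    exact (Ideal.mul_unit_mem_iff_mem _ hun).1 h1
  choose N hN using hX
  let M := ∑ i, N i
  have hM : ∀ i, algebraMap (MvPolynomial (Fin n) K) (LocAt K (0 : Fin n → K)) (X i ^ M) ∈ J := by
    intro i
    have : N i ≤ M := Finset.single_le_sum (f := N) (fun _ _ => Nat.zero_le _) (Finset.mem_univ i)
    rw [← Nat.sub_add_cancel this, pow_add, map_mul]
    exact Ideal.mul_mem_left _ _ (hN i)
  -- truncation
  let T := n * M + 1
  let r : MvPolynomial (Fin n) K := ∑ i, MvPowerSeries.truncTotal T (c i) * pderiv i f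
  have hr : algebraMap (MvPolynomial (Fin n) K) (LocAt K (0 : Fin n → K)) r ∈ J := by
    rw [map_sum]
    refine Ideal.sum_mem _ fun i _ => ?_
    rw [map_mul]
    exact Ideal.mul_mem_left _ _ (Ideal.subset_span ⟨i, rfl⟩)
  have hfr : algebraMap (MvPolynomial (Fin n) K) (LocAt K (0 : Fin n → K)) (f - r) ∈ J := by
    refine box_mem M _ ?_ _ J hM
    intro e he
    have hdeg : e.degree < T := by
      rw [Finsupp.degree_eq_sum]
      have : ∑ i, e i ≤ ∑ _i : Fin n, M := Finset.sum_le_sum fun i _ => (he i).le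
      simp at this
      omega
    have hps : ((f - r : MvPolynomial (Fin n) K) : MvPowerSeries (Fin n) K) ∈ FF K n T := by
      have e1 : ((f - r : MvPolynomial (Fin n) K) : MvPowerSeries (Fin n) K) =
          ∑ i, (c i - (MvPowerSeries.truncTotal T (c i) : MvPolynomial (Fin n) K)) *
            ((pderiv i f : MvPolynomial (Fin n) K) : MvPowerSeries (Fin n) K) := by
        have e2 : ((f - r : MvPolynomial (Fin n) K) : MvPowerSeries (Fin n) K) =
            (f : MvPowerSeries (Fin n) K) - (r : MvPowerSeries (Fin n) K) :=
          map_sub (MvPolynomial.coeToMvPowerSeries.ringHom) f r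
        have e3 : (r : MvPowerSeries (Fin n) K) = ∑ i,
            ((MvPowerSeries.truncTotal T (c i) : MvPolynomial (Fin n) K) :
              MvPowerSeries (Fin n) K) *
            ((pderiv i f : MvPolynomial (Fin n) K) : MvPowerSeries (Fin n) K) := by
          have := map_sum (MvPolynomial.coeToMvPowerSeries.ringHom)
            (fun i => MvPowerSeries.truncTotal T (c i) * pderiv i f) Finset.univ
          simp only [map_mul] at this
          exact this
        rw [e2, e3]
        nth_rewrite 1 [hc]
        rw [← Finset.sum_sub_distrib]
        exact Finset.sum_congr rfl fun i _ => by ring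
      rw [e1]
      refine Ideal.sum_mem _ fun i _ => Ideal.mul_mem_right _ _ ?_
      intro e' he'
      rw [map_sub, MvPolynomial.coeff_coe, MvPowerSeries.coeff_truncTotal _ he', sub_self]
    have := hps e hdeg
    rwa [MvPolynomial.coeff_coe] at this
  have := Ideal.add_mem _ hfr hr
  rw [← map_add, sub_add_cancel] at this
  exact this

end
end
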